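/- Let d > 0, let Ω ⊂ ℝ² be an open bounded domain with smooth boundary, and let a : cl(Ω) → ℝ² be a continuously differentiable vector field with div a = 0 on Ω. Assume f satisfies (F), g satisfies (G-ext), f'(0) + ln(g'(0)) > 0, and vol(Ω) < V_ex := 2dπ/(f'(0) + ln(g'(0))). Then every solution of the impulsive reaction–diffusion system on Ω satisfies lim_{m→∞} N_m(x) = 0 for every x ∈ Ω. -/

import Mathlib

open Real Filter MeasureTheory
open scoped Topology ENNReal

noncomputable section

/-- First-order partial derivative of `u` in the `i`-th coordinate direction. -/
def pd {n : ℕ} (u : EuclideanSpace ℝ (Fin n) → ℝ) (i : Fin n)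
    (x : EuclideanSpace ℝ (Fin n)) : ℝ :=
  fderiv ℝ u x (EuclideanSpace.single i 1)

/-- Second-order partial derivative `∂ᵢ∂ⱼ u`. -/
def pd2 {n : ℕ} (u : EuclideanSpace ℝ (Fin n) → ℝ) (i j : Fin n)
    (x : EuclideanSpace ℝ (Fin n)) : ℝ :=
  pd (fun y => pd u j y) i x

/-- Laplacian of `u`. -/
def lap {n : ℕ} (u : EuclideanSpace ℝ (Fin n) → ℝ) (x : EuclideanSpace ℝ (Fin n)) : ℝ :=
  ∑ i, pd2 u i i x

/-- Assumption (F): `f` is locally Lipschitz, `f 0 = 0`, `f` is differentiable at `0`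
with derivative `f'0 ≠ 0`, and there is a differentiable `h` with `h 0 = h' 0 = 0` such that
`f'0 * N - h N ≤ f N ≤ f'0 * N` for all `N ≥ 0`. -/
def SatF (f : ℝ → ℝ) (f'0 : ℝ) : Prop :=
  LocallyLipschitz f ∧ f 0 = 0 ∧ HasDerivAt f f'0 0 ∧ f'0 ≠ 0 ∧
    ∃ h : ℝ → ℝ, Differentiable ℝ h ∧ h 0 = 0 ∧ deriv h 0 = 0 ∧
      ∀ N : ℝ, 0 ≤ N → f'0 * N - h N ≤ f N ∧ f N ≤ f'0 * N

/-- Assumption (G-ext): `g : [0,∞) → [0,∞)` is continuous, `g 0 = 0`, `g N > 0` for `N > 0`,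
`g` is differentiable at `0` (within `[0,∞)`) with derivative `g'0 > 0`, and
`g N ≤ g'0 * N` for all `N > 0`. -/
def SatGext (g : ℝ → ℝ) (g'0 : ℝ) : Prop :=
  ContinuousOn g (Set.Ici 0) ∧ g 0 = 0 ∧ (∀ N : ℝ, 0 < N → 0 < g N) ∧
    HasDerivWithinAt g g'0 (Set.Ici 0) 0 ∧ 0 < g'0 ∧ ∀ N : ℝ, 0 < N → g N ≤ g'0 * N

/-- `Ω` has a `C^k` boundary: near every boundary point, `Ω` is the sublevel set of a
`C^k` function with nonvanishing differential, whose zero set is the boundary. -/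
def HasCkBoundary {n : ℕ} (k : ℕ∞) (Ω : Set (EuclideanSpace ℝ (Fin n))) : Prop :=
  ∀ x ∈ frontier Ω, ∃ U : Set (EuclideanSpace ℝ (Fin n)),
    ∃ φ : EuclideanSpace ℝ (Fin n) → ℝ,
      IsOpen U ∧ x ∈ U ∧ ContDiffOn ℝ k φ U ∧ (∀ y ∈ U, fderiv ℝ φ y ≠ 0) ∧
        Ω ∩ U = {y ∈ U | φ y < 0} ∧ frontier Ω ∩ U = {y ∈ U | φ y = 0}

/-- A solution of the impulsive reaction-diffusion system
`∂ₜ u⁽ᵐ⁾ = d Δu⁽ᵐ⁾ - a ⬝ ∇u⁽ᵐ⁾ + f (u⁽ᵐ⁾)` on `Ω × (0,1]` with hostile (Dirichlet) boundary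
conditions, initial data `u⁽ᵐ⁾(·,0) = g (N_m ·)` and update rule `N_{m+1} = u⁽ᵐ⁾(·,1)`. -/
structure ImpSol (n : ℕ) (Ω : Set (EuclideanSpace ℝ (Fin n))) (d : ℝ)
    (a : EuclideanSpace ℝ (Fin n) → EuclideanSpace ℝ (Fin n)) (f g : ℝ → ℝ) where
  N : ℕ → EuclideanSpace ℝ (Fin n) → ℝ
  u : ℕ → EuclideanSpace ℝ (Fin n) → ℝ → ℝ
  N_cont : ∀ m, ContinuousOn (N m) (closure Ω)
  N_nonneg : ∀ m, ∀ x ∈ closure Ω, 0 ≤ N m x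
  N0_bdry : ∀ x ∈ frontier Ω, N 0 x = 0
  u_nonneg : ∀ m, ∀ x ∈ closure Ω, ∀ t ∈ Set.Icc (0:ℝ) 1, 0 ≤ u m x t
  u_cont : ∀ m, ContinuousOn (fun p : EuclideanSpace ℝ (Fin n) × ℝ => u m p.1 p.2)
    (closure Ω ×ˢ Set.Icc (0:ℝ) 1)
  u_space_C2 : ∀ m, ∀ t ∈ Set.Ioc (0:ℝ) 1, ∀ x ∈ Ω, ContDiffAt ℝ 2 (fun y => u m y t) x
  u_time_C1 : ∀ m, ∀ x ∈ Ω, ∀ t ∈ Set.Ioc (0:ℝ) 1, ContDiffAt ℝ 1 (fun s => u m x s) t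
  pde : ∀ m, ∀ x ∈ Ω, ∀ t ∈ Set.Ioc (0:ℝ) 1,
    deriv (fun s => u m x s) t =
      d * lap (fun y => u m y t) x - (∑ i, a x i * pd (fun y => u m y t) i x) + f (u m x t)
  bdry : ∀ m, ∀ x ∈ frontier Ω, ∀ t ∈ Set.Ioc (0:ℝ) 1, u m x t = 0
  init : ∀ m, ∀ x ∈ Ω, u m x 0 = g (N m x)
  recur : ∀ m, ∀ x ∈ closure Ω, N (m + 1) x = u m x 1


abbrev E2 := EuclideanSpace ℝ (Fin 2)

lemma hasDerivAt_max_pow (n : ℕ) (hn : 2 ≤ n) (s : ℝ) :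
    HasDerivAt (fun s : ℝ => (max s 0) ^ n) (n * (max s 0) ^ (n - 1)) s := by
  have h1 : HasDerivAt (fun s : ℝ => s ^ n) (n * s ^ (n - 1)) s := hasDerivAt_pow n s
  rcases lt_trichotomy s 0 with h | h | h
  · rw [max_eq_right h.le, zero_pow (by omega), mul_zero]
    refine (hasDerivAt_const s (0:ℝ)).congr_of_eventuallyEq ?_
    filter_upwards [eventually_lt_nhds h] with y hy
    rw [max_eq_right hy.le, zero_pow (by omega)]
  · subst h
    have h2 : HasDerivWithinAt (fun s : ℝ => (max s 0) ^ n) (n * (max (0:ℝ) 0) ^ (n - 1))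
        (Set.Iic 0 ∪ Set.Ici 0) 0 := by
      refine HasDerivWithinAt.union ?_ ?_
      · rw [max_self, zero_pow (by omega), mul_zero]
        refine (hasDerivWithinAt_const (0:ℝ) _ (0:ℝ)).congr ?_ ?_
        · intro y hy
          rw [max_eq_right hy, zero_pow (by omega)]
        · simp; omega
      · rw [max_self]
        refine h1.hasDerivWithinAt.congr ?_ ?_
        · intro y hy
          rw [max_eq_left hy]
        · simp
    rw [Set.Iic_union_Ici] at h2
    exact hasDerivWithinAt_univ.mp h2
  · rw [max_eq_left h.le]
    refine h1.congr_of_eventuallyEq ?_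
    filter_upwards [eventually_gt_nhds h] with y hy
    rw [max_eq_left hy.le]

lemma hasDerivAt_max_rpow (s : ℝ) :
    HasDerivAt (fun s : ℝ => (max s 0) ^ (3/2:ℝ)) ((3/2:ℝ) * (max s 0) ^ (1/2:ℝ)) s := by
  have h1 : HasDerivAt (fun s : ℝ => s ^ (3/2:ℝ)) ((3/2:ℝ) * s ^ (1/2:ℝ)) s := by
    have := Real.hasDerivAt_rpow_const (x := s) (p := 3/2) (Or.inr (by norm_num))
    norm_num at this ⊢
    exact this
  rcases lt_trichotomy s 0 with h | h | h
  · rw [max_eq_right h.le, Real.zero_rpow (by norm_num), mul_zero]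
    refine (hasDerivAt_const s (0:ℝ)).congr_of_eventuallyEq ?_
    filter_upwards [eventually_lt_nhds h] with y hy
    rw [max_eq_right hy.le, Real.zero_rpow (by norm_num)]
  · subst h
    have h2 : HasDerivWithinAt (fun s : ℝ => (max s 0) ^ (3/2:ℝ))
        ((3/2:ℝ) * (max (0:ℝ) 0) ^ (1/2:ℝ))
        (Set.Iic 0 ∪ Set.Ici 0) 0 := by
      refine HasDerivWithinAt.union ?_ ?_
      · rw [max_self, Real.zero_rpow (by norm_num), mul_zero]
        refine (hasDerivWithinAt_const (0:ℝ) _ (0:ℝ)).congr ?_ ?_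
        · intro y hy
          rw [max_eq_right hy, Real.zero_rpow (by norm_num)]
        · rw [max_self, Real.zero_rpow (by norm_num)]
      · rw [max_self]
        refine h1.hasDerivWithinAt.congr ?_ ?_
        · intro y hy
          rw [max_eq_left hy]
        · simp
    rw [Set.Iic_union_Ici] at h2
    exact hasDerivWithinAt_univ.mp h2
  · rw [max_eq_left h.le]
    refine h1.congr_of_eventuallyEq ?_
    filter_upwards [eventually_gt_nhds h] with y hy
    rw [max_eq_left hy.le]

lemma weak_max {D : Set E2} (hD : IsOpen D) (hb : Bornology.IsBounded D) {t0 : ℝ}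
    (z : E2 → ℝ → ℝ)
    (hc : ContinuousOn (fun p : E2 × ℝ => z p.1 p.2) (closure D ×ˢ Set.Icc t0 1))
    (h0 : ∀ x ∈ closure D, z x t0 ≤ 0)
    (hf : ∀ x ∈ frontier D, ∀ t ∈ Set.Icc t0 1, z x t ≤ 0)
    (hdt : ∀ x ∈ D, ∀ t ∈ Set.Ioc t0 1, 0 < z x t → IsLocalMax (fun y => z y t) x →
      ∃ z', HasDerivAt (z x) z' t ∧ z' < 0) :
    ∀ x ∈ closure D, ∀ t ∈ Set.Icc t0 1, z x t ≤ 0 := by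
  intro x hx t ht
  by_contra! hpos
  have hcomp : IsCompact (closure D ×ˢ Set.Icc t0 1) :=
    (Metric.isCompact_of_isClosed_isBounded isClosed_closure hb.closure).prod isCompact_Icc
  obtain ⟨⟨x1, t1⟩, hmem, hmax⟩ := hcomp.exists_isMaxOn ⟨(x, t), ⟨hx, ht⟩⟩ hc
  obtain ⟨hx1, ht1⟩ := hmem
  simp only at hx1 ht1
  have hp1 : 0 < z x1 t1 := lt_of_lt_of_le hpos (hmax (show (x, t) ∈ _ from ⟨hx, ht⟩))
  have hxD : x1 ∈ D := by
    by_contra hn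
    have : x1 ∈ frontier D := by
      rw [hD.frontier_eq]; exact ⟨hx1, hn⟩
    linarith [hf x1 this t1 ht1]
  have htt : t0 < t1 := by
    rcases ht1.1.eq_or_lt with h | h
    · subst h; linarith [h0 x1 hx1]
    · exact h
  have hloc : IsLocalMax (fun y => z y t1) x1 := by
    filter_upwards [hD.mem_nhds hxD] with y hy
    exact hmax (show (y, t1) ∈ _ from ⟨subset_closure hy, ht1⟩)
  obtain ⟨z', hz', hneg⟩ := hdt x1 hxD t1 ⟨htt, ht1.2⟩ hp1 hloc
  rw [hasDerivAt_iff_tendsto_slope] at hz'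
  have h1 : ∀ᶠ s in 𝓝[<] t1, slope (z x1) t1 s < 0 := (hz'.mono_left (nhdsWithin_mono t1 (fun y (hy : y < t1) => ne_of_lt hy))).eventually
    (eventually_lt_nhds hneg)
  have h2 : ∀ᶠ s in 𝓝[<] t1, s ∈ Set.Ioo t0 t1 := Ioo_mem_nhdsLT htt
  obtain ⟨s, hs1, hs2⟩ := (h1.and h2).exists
  have h3 : z x1 s ≤ z x1 t1 := hmax (show (x1, s) ∈ _ from ⟨hx1, hs2.1.le, hs2.2.le.trans ht1.2⟩)
  rw [slope_def_field] at hs1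
  have : 0 ≤ (z x1 s - z x1 t1) / (s - t1) :=
    div_nonneg_of_nonpos (by linarith) (by linarith [hs2.2])
  linarith

lemma line_hasDerivAt {w : E2 → ℝ} {x v : E2} {s : ℝ} (h : DifferentiableAt ℝ w (x + s • v)) :
    HasDerivAt (fun s : ℝ => w (x + s • v)) (fderiv ℝ w (x + s • v) v) s := by
  have h1 : HasDerivAt (fun s : ℝ => x + s • v) v s := by
    simpa using ((hasDerivAt_id s).smul_const v).const_add x
  exact h.hasFDerivAt.comp_hasDerivAt s h1

lemma contDiffAt_pd {w : E2 → ℝ} {x : E2} (h : ContDiffAt ℝ 2 w x) (i : Fin 2) :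
    ContDiffAt ℝ 1 (pd w i) x := by
  have : ContDiffAt ℝ 1 (fderiv ℝ w) x := h.fderiv_right (by norm_num)
  exact this.clm_apply contDiffAt_const

lemma ev_contDiffAt {w : E2 → ℝ} {x : E2} (h : ContDiffAt ℝ 2 w x) :
    ∀ᶠ y in 𝓝 x, ContDiffAt ℝ 2 w y := h.eventually (by simp)

/-- second derivative test -/
lemma pd_pd2_of_localMax {w : E2 → ℝ} {x : E2} (h : ContDiffAt ℝ 2 w x) (hm : IsLocalMax w x)
    (i : Fin 2) : pd w i x = 0 ∧ pd2 w i i x ≤ 0 := by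
  have h0 : fderiv ℝ w x = 0 := hm.fderiv_eq_zero
  refine ⟨by simp [pd, h0], ?_⟩
  by_contra! hpos
  set v : E2 := EuclideanSpace.single i 1
  let φ : ℝ → ℝ := fun s => w (x + s • v)
  have hline : Tendsto (fun s : ℝ => x + s • v) (𝓝 0) (𝓝 x) := by
    have : Continuous (fun s : ℝ => x + s • v) := by fun_prop
    simpa using this.tendsto 0
  have hev : ∀ᶠ s in 𝓝 (0:ℝ), HasDerivAt φ (pd w i (x + s • v)) s := by
    filter_upwards [hline.eventually (ev_contDiffAt h)] with s hs
    exact line_hasDerivAt (hs.differentiableAt (by norm_num))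
  have hev' : deriv φ =ᶠ[𝓝 0] fun s => pd w i (x + s • v) := by
    filter_upwards [hev] with s hs using hs.deriv
  have hd2 : HasDerivAt (fun s : ℝ => pd w i (x + s • v)) (pd2 w i i x) 0 := by
    have := line_hasDerivAt (w := pd w i) (x := x) (v := v) (s := 0)
      (by simpa using (contDiffAt_pd h i).differentiableAt (by norm_num))
    rw [zero_smul, add_zero] at this
    exact this
  have hd2' : deriv (deriv φ) 0 = pd2 w i i x := by
    rw [hev'.deriv_eq]; exact hd2.deriv
  have hφ0 : deriv φ 0 = 0 := by
    rw [hev'.eq_of_nhds]; simp [pd, h0]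
  have hcont : ContinuousAt φ 0 := hev.self_of_nhds.continuousAt
  have hmin := isLocalMin_of_deriv_deriv_pos (by rw [hd2']; exact hpos) hφ0 hcont
  have hmax : IsLocalMax φ 0 := by
    have := hline.eventually hm
    filter_upwards [this] with s hs
    simpa [φ] using hs
  have hconst : φ =ᶠ[𝓝 0] fun _ => φ 0 := by
    filter_upwards [hmin, hmax] with s h1 h2
    exact le_antisymm h2 h1
  have hder : deriv φ =ᶠ[𝓝 0] fun _ => 0 := by
    have := hconst.deriv
    simpa using this
  have : deriv (deriv φ) 0 = 0 := by rw [hder.deriv_eq]; simp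
  linarith

lemma hasFDerivAt_quad (x0 : E2) (p : E2 →L[ℝ] ℝ) (c C : ℝ) (y : E2) :
    HasFDerivAt (fun y : E2 => c + p (y - x0) + C * ‖y - x0‖ ^ 2)
      (p + C • (2 • innerSL ℝ (y - x0))) y := by
  have h1 : HasFDerivAt (fun y : E2 => y - x0) (ContinuousLinearMap.id ℝ E2) y :=
    (hasFDerivAt_id y).sub_const x0
  have h2 := (p.hasFDerivAt (x := y - x0)).comp y h1
  have h3 := (h1.norm_sq).const_mul C
  have h4 := (h2.const_add c).add h3
  exact h4.congr_fderiv (by simp)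

lemma pd_quad (x0 : E2) (p : E2 →L[ℝ] ℝ) (c C : ℝ) (i : Fin 2) (y : E2) :
    pd (fun y : E2 => c + p (y - x0) + C * ‖y - x0‖ ^ 2) i y =
      p (EuclideanSpace.single i 1) + 2 * C * (y i - x0 i) := by
  rw [pd, (hasFDerivAt_quad x0 p c C y).fderiv]
  simp [EuclideanSpace.inner_single_right]
  ring

lemma pd_sub {v b : E2 → ℝ} {x : E2} (hv : DifferentiableAt ℝ v x) (hb : DifferentiableAt ℝ b x)
    (i : Fin 2) : pd (fun y => v y - b y) i x = pd v i x - pd b i x := by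
  simp only [pd]
  rw [fderiv_fun_sub hv hb]; rfl

lemma hasFDerivAt_coord (i : Fin 2) (x : E2) :
    HasFDerivAt (fun y : E2 => y i) (EuclideanSpace.proj i : E2 →L[ℝ] ℝ) x :=
  (EuclideanSpace.proj i : E2 →L[ℝ] ℝ).hasFDerivAt

lemma pd2_quad (x0 : E2) (p : E2 →L[ℝ] ℝ) (c C : ℝ) (i : Fin 2) (y : E2) :
    pd2 (fun y : E2 => c + p (y - x0) + C * ‖y - x0‖ ^ 2) i i y = 2 * C := by
  rw [pd2]
  simp_rw [pd_quad]
  rw [pd]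
  have := (((hasFDerivAt_coord i y).sub_const (x0 i)).const_mul (2 * C)).const_add
    (p (EuclideanSpace.single i 1))
  rw [this.fderiv]
  simp

lemma contDiff_quad (x0 : E2) (p : E2 →L[ℝ] ℝ) (c C : ℝ) :
    ContDiff ℝ 2 (fun y : E2 => c + p (y - x0) + C * ‖y - x0‖ ^ 2) := by
  have h1 : ContDiff ℝ 2 (fun y : E2 => y - x0) := by fun_prop
  exact (contDiff_const.add (p.contDiff.comp h1)).add (contDiff_const.mul (h1.norm_sq ℝ))

lemma pd2_sub {v b : E2 → ℝ} {x : E2} (hv : ContDiffAt ℝ 2 v x) (hb : ContDiffAt ℝ 2 b x)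
    (i : Fin 2) : pd2 (fun y => v y - b y) i i x = pd2 v i i x - pd2 b i i x := by
  have : (fun y => pd (fun y => v y - b y) i y) =ᶠ[𝓝 x] fun y => pd v i y - pd b i y := by
    filter_upwards [ev_contDiffAt hv, ev_contDiffAt hb] with y h1 h2
    exact pd_sub (h1.differentiableAt (by norm_num)) (h2.differentiableAt (by norm_num)) i
  rw [pd2, pd, this.fderiv_eq]
  exact pd_sub ((contDiffAt_pd hv i).differentiableAt (by norm_num))
    ((contDiffAt_pd hb i).differentiableAt (by norm_num)) i

lemma taylor_bound {w : E2 → ℝ} {x0 : E2} {ρ C : ℝ}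
    (hw : ∀ x ∈ Metric.closedBall x0 ρ, ContDiffAt ℝ 2 w x)
    (hC : ∀ x ∈ Metric.closedBall x0 ρ, ‖fderiv ℝ (fderiv ℝ w) x‖ ≤ C)
    (x : E2) (hx : x ∈ Metric.closedBall x0 ρ) :
    w x ≤ w x0 + fderiv ℝ w x0 (x - x0) + C * ‖x - x0‖ ^ 2 := by
  set R := ‖x - x0‖ with hR
  have hsub : Metric.closedBall x0 R ⊆ Metric.closedBall x0 ρ := by
    apply Metric.closedBall_subset_closedBall
    rw [Metric.mem_closedBall, dist_eq_norm] at hx; exact hx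
  have hC0 : 0 ≤ C := (norm_nonneg (fderiv ℝ (fderiv ℝ w) x)).trans (hC x hx)
  have hR0 : 0 ≤ R := norm_nonneg _
  have hx0 : x0 ∈ Metric.closedBall x0 R := Metric.mem_closedBall_self hR0
  have hxR : x ∈ Metric.closedBall x0 R := by
    rw [Metric.mem_closedBall, dist_eq_norm]
  have h1 : ∀ y ∈ Metric.closedBall x0 R, ‖fderiv ℝ w y - fderiv ℝ w x0‖ ≤ C * R := by
    intro y hy
    have := (convex_closedBall x0 R).norm_image_sub_le_of_norm_fderiv_le (𝕜 := ℝ)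
      (f := fderiv ℝ w) (C := C)
      (fun z hz => ((hw z (hsub hz)).fderiv_right (m := 1) (by norm_num)).differentiableAt (by norm_num))
      (fun z hz => hC z (hsub hz)) hx0 hy
    refine this.trans (mul_le_mul_of_nonneg_left ?_ hC0)
    rw [Metric.mem_closedBall, dist_eq_norm] at hy; exact hy
  have h2 := (convex_closedBall x0 R).norm_image_sub_le_of_norm_fderiv_le' (𝕜 := ℝ)
      (f := w) (C := C * R) (φ := fderiv ℝ w x0)
      (fun z hz => (hw z (hsub hz)).differentiableAt (by norm_num)) h1 hx0 hxR
  rw [Real.norm_eq_abs] at h2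
  have := (abs_le.mp h2).2
  rw [← hR] at this
  nlinarith

lemma time_lip_one {Ω : Set E2} (hopen : IsOpen Ω) {d A M S : ℝ} (hd : 0 < d)
    {a : E2 → E2} (ha : ∀ x ∈ Ω, ∀ i, |a x i| ≤ A) {v : E2 → ℝ → ℝ}
    (hcont : ContinuousOn (fun p : E2 × ℝ => v p.1 p.2) (closure Ω ×ˢ Set.Icc (0:ℝ) 1))
    (hC2 : ∀ t ∈ Set.Ioc (0:ℝ) 1, ∀ x ∈ Ω, ContDiffAt ℝ 2 (fun y => v y t) x)
    (hC1 : ∀ x ∈ Ω, ∀ t ∈ Set.Ioc (0:ℝ) 1, DifferentiableAt ℝ (fun s => v x s) t)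
    (hpde : ∀ x ∈ Ω, ∀ t ∈ Set.Ioc (0:ℝ) 1, deriv (fun s => v x s) t ≤
      d * lap (fun y => v y t) x - (∑ i, a x i * pd (fun y => v y t) i x) + M)
    (hS : ∀ x ∈ closure Ω, ∀ t ∈ Set.Icc (0:ℝ) 1, |v x t| ≤ S)
    {t0 : ℝ} (ht0 : 0 < t0) {K : Set E2} (hK : IsCompact K) (hKΩ : K ⊆ Ω) :
    ∃ C, ∀ x ∈ K, ∀ t ∈ Set.Icc t0 1, v x t - v x t0 ≤ C * (t - t0) := by
  by_cases ht01 : t0 ≤ 1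
  swap
  · exact ⟨0, fun x _ t ht => absurd (ht.1.trans ht.2) ht01⟩
  obtain ⟨ρ, hρ, hρΩ⟩ := hK.exists_cthickening_subset_open hopen hKΩ
  have hK' : IsCompact (Metric.cthickening ρ K) := hK.cthickening
  set w : E2 → ℝ := fun y => v y t0 with hw
  have hwC2 : ∀ x ∈ Metric.cthickening ρ K, ContDiffAt ℝ 2 w x :=
    fun x hx => hC2 t0 ⟨ht0, ht01⟩ x (hρΩ hx)
  have hc1 : ContinuousOn (fderiv ℝ w) (Metric.cthickening ρ K) := fun x hx =>
    ((hwC2 x hx).fderiv_right (m := 1) (by norm_num)).continuousAt.continuousWithinAt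
  have hc2 : ContinuousOn (fderiv ℝ (fderiv ℝ w)) (Metric.cthickening ρ K) := fun x hx =>
    (((hwC2 x hx).fderiv_right (m := 1) (by norm_num)).fderiv_right (m := 0)
      (by norm_num)).continuousAt.continuousWithinAt
  obtain ⟨P, hP⟩ := hK'.exists_bound_of_continuousOn hc1
  obtain ⟨C, hC⟩ := hK'.exists_bound_of_continuousOn (f := fderiv ℝ (fderiv ℝ w)) hc2
  rcases K.eq_empty_or_nonempty with hKe | ⟨k, hk⟩
  · exact ⟨0, fun x hx => by simp [hKe] at hx⟩
  have hk' : k ∈ Metric.cthickening ρ K := Metric.self_subset_cthickening K hk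
  have hP0 : 0 ≤ P := (norm_nonneg _).trans (hP k hk')
  have hC0 : 0 ≤ C := (norm_nonneg (fderiv ℝ (fderiv ℝ w) k)).trans (hC k hk')
  have hA0 : 0 ≤ A := (abs_nonneg _).trans (ha k (hKΩ hk) 0)
  have hS0 : 0 ≤ S := (abs_nonneg _).trans (hS k (subset_closure (hKΩ hk)) t0 ⟨ht0.le, ht01⟩)
  set C1 := C + (2 * S + P * ρ) / ρ ^ 2 with hC1def
  have hC1C : C ≤ C1 := by
    have : 0 ≤ (2 * S + P * ρ) / ρ ^ 2 := by positivity
    linarith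
  have hC10 : 0 ≤ C1 := hC0.trans hC1C
  have hC1ρ : 2 * S + P * ρ ≤ C1 * ρ ^ 2 := by
    have : (2 * S + P * ρ) / ρ ^ 2 * ρ ^ 2 = 2 * S + P * ρ := by field_simp
    rw [hC1def, add_mul, this]
    nlinarith [sq_nonneg ρ]
  set L := 4 * d * C1 + 2 * (A * (P + 2 * C1 * ρ)) + |M| + 1 with hL
  have hL0 : 0 ≤ L := by positivity
  refine ⟨L, fun x0 hx0 t ht => ?_⟩
  set p := fderiv ℝ w x0 with hp
  have hpP : ‖p‖ ≤ P := hP x0 (Metric.self_subset_cthickening K hx0)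
  have hball : Metric.closedBall x0 ρ ⊆ Metric.cthickening ρ K :=
    Metric.closedBall_subset_cthickening hx0 ρ
  have htay := taylor_bound (w := w) (x0 := x0) (ρ := ρ) (C := C)
    (fun x hx => hwC2 x (hball hx)) (fun x hx => hC x (hball hx))
  let b : E2 → ℝ := fun y => w x0 + p (y - x0) + C1 * ‖y - x0‖ ^ 2
  have hbcd : ContDiff ℝ 2 b := contDiff_quad x0 p (w x0) C1
  have hcl : closure (Metric.ball x0 ρ) = Metric.closedBall x0 ρ := closure_ball x0 hρ.ne'
  have hfr : frontier (Metric.ball x0 ρ) = Metric.sphere x0 ρ := frontier_ball x0 hρ.ne'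
  have key := weak_max (D := Metric.ball x0 ρ) Metric.isOpen_ball Metric.isBounded_ball (t0 := t0)
    (fun y s => v y s - b y - L * (s - t0)) ?_ ?_ ?_ ?_ x0
    (subset_closure (Metric.mem_ball_self hρ)) t ht
  · simp only [b, sub_self, map_zero, norm_zero, hw] at key
    norm_num at key
    linarith
  · rw [hcl]
    refine ContinuousOn.sub (ContinuousOn.sub ?_ ?_) ?_
    · refine hcont.mono (Set.prod_mono ((hball.trans hρΩ).trans subset_closure) ?_)
      exact Set.Icc_subset_Icc ht0.le le_rfl
    · exact (hbcd.continuous.comp continuous_fst).continuousOn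
    · fun_prop
  · intro x hx
    rw [hcl] at hx
    have := htay x hx
    simp only [sub_self, mul_zero, sub_zero, b]
    have h2 : C * ‖x - x0‖ ^ 2 ≤ C1 * ‖x - x0‖ ^ 2 :=
      mul_le_mul_of_nonneg_right hC1C (by positivity)
    simp only [hw] at this ⊢
    linarith
  · intro x hx s hs
    rw [hfr] at hx
    have hxn : ‖x - x0‖ = ρ := by simpa [dist_eq_norm] using hx
    have hxΩ : x ∈ Ω := hρΩ (hball (Metric.sphere_subset_closedBall hx))
    have h1 := (abs_le.mp (hS x (subset_closure hxΩ) s ⟨ht0.le.trans hs.1, hs.2⟩)).2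
    have h2 := (abs_le.mp (hS x0 (subset_closure (hKΩ hx0)) t0 ⟨ht0.le, ht01⟩)).1
    have h3 : |p (x - x0)| ≤ P * ρ := by
      have := p.le_opNorm (x - x0)
      rw [hxn, Real.norm_eq_abs] at this
      exact this.trans (mul_le_mul_of_nonneg_right hpP hρ.le)
    have h4 := (abs_le.mp h3).1
    have h5 : 0 ≤ L * (s - t0) := mul_nonneg hL0 (by linarith [hs.1])
    simp only [b, hxn, hw]
    linarith
  · intro x hx s hs hpos hmax
    have hxc : x ∈ Metric.closedBall x0 ρ := Metric.ball_subset_closedBall hx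
    have hxΩ : x ∈ Ω := hρΩ (hball hxc)
    have hs' : s ∈ Set.Ioc (0:ℝ) 1 := ⟨ht0.trans hs.1, hs.2⟩
    have hvC2 := hC2 s hs' x hxΩ
    have hmax' : IsLocalMax (fun y => v y s - b y) x := by
      filter_upwards [hmax] with y hy
      simpa using hy
    have htest := pd_pd2_of_localMax (hvC2.sub hbcd.contDiffAt) hmax'
    have hpd : ∀ i, pd (fun y => v y s) i x = p (EuclideanSpace.single i 1) + 2 * C1 * (x i - x0 i) := by
      intro i
      have := (htest i).1
      rw [pd_sub (hvC2.differentiableAt (by norm_num)) (hbcd.contDiffAt.differentiableAt (by norm_num)),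
        pd_quad] at this
      linarith
    have hpd2 : ∀ i, pd2 (fun y => v y s) i i x ≤ 2 * C1 := by
      intro i
      have := (htest i).2
      rw [pd2_sub hvC2 hbcd.contDiffAt, pd2_quad] at this
      linarith
    refine ⟨deriv (fun s => v x s) s - L, ?_, ?_⟩
    · have h1 := (hC1 x hxΩ s hs').hasDerivAt
      have h2 : HasDerivAt (fun s : ℝ => L * (s - t0)) L s := by
        simpa using ((hasDerivAt_id s).sub_const t0).const_mul L
      exact (h1.sub_const (b x)).sub h2
    · have h1 := hpde x hxΩ s hs'
      have hlap : lap (fun y => v y s) x ≤ 4 * C1 := by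
        rw [lap, Fin.sum_univ_two]
        linarith [hpd2 0, hpd2 1]
      have hnx : ‖x - x0‖ ≤ ρ := by
        rw [Metric.mem_closedBall, dist_eq_norm] at hxc; exact hxc
      have hterm : ∀ i, -(a x i * pd (fun y => v y s) i x) ≤ A * (P + 2 * C1 * ρ) := by
        intro i
        have e1 : |pd (fun y => v y s) i x| ≤ P + 2 * C1 * ρ := by
          rw [hpd i]
          refine (abs_add_le _ _).trans (add_le_add ?_ ?_)
          · have := p.le_opNorm (EuclideanSpace.single i 1)
            simp at this
            exact this.trans hpP
          · rw [abs_mul, abs_of_nonneg (by positivity : 0 ≤ 2 * C1)]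
            refine mul_le_mul_of_nonneg_left ?_ (by positivity)
            have := PiLp.norm_apply_le (x - x0) i
            simp only [PiLp.sub_apply, Real.norm_eq_abs] at this
            exact this.trans hnx
        calc -(a x i * pd (fun y => v y s) i x) ≤ |a x i * pd (fun y => v y s) i x| := neg_le_abs _
          _ = |a x i| * |pd (fun y => v y s) i x| := abs_mul _ _
          _ ≤ _ := mul_le_mul (ha x hxΩ i) e1 (abs_nonneg _) hA0
      rw [Fin.sum_univ_two] at h1
      have h3 : d * lap (fun y => v y s) x ≤ d * (4 * C1) := mul_le_mul_of_nonneg_left hlap hd.le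
      have := hterm 0
      have := hterm 1
      have := le_abs_self M
      rw [hL]
      linarith

structure OneSol (Ω : Set E2) (d : ℝ) (a : E2 → E2) (f : ℝ → ℝ) (u : E2 → ℝ → ℝ) : Prop where
  nonneg : ∀ x ∈ closure Ω, ∀ t ∈ Set.Icc (0:ℝ) 1, 0 ≤ u x t
  cont : ContinuousOn (fun p : E2 × ℝ => u p.1 p.2) (closure Ω ×ˢ Set.Icc (0:ℝ) 1)
  C2 : ∀ t ∈ Set.Ioc (0:ℝ) 1, ∀ x ∈ Ω, ContDiffAt ℝ 2 (fun y => u y t) x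
  C1 : ∀ x ∈ Ω, ∀ t ∈ Set.Ioc (0:ℝ) 1, DifferentiableAt ℝ (fun s => u x s) t
  pde : ∀ x ∈ Ω, ∀ t ∈ Set.Ioc (0:ℝ) 1,
    deriv (fun s => u x s) t =
      d * lap (fun y => u y t) x - (∑ i, a x i * pd (fun y => u y t) i x) + f (u x t)
  bdry : ∀ x ∈ frontier Ω, ∀ t ∈ Set.Icc (0:ℝ) 1, u x t = 0

lemma pd_neg (v : E2 → ℝ) (i : Fin 2) : pd (fun y => - v y) i = fun x => - pd v i x := by
  funext x
  simp only [pd]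
  rw [fderiv_fun_neg]; rfl

lemma lap_neg (v : E2 → ℝ) (x : E2) : lap (fun y => - v y) x = - lap v x := by
  simp only [lap, pd2, pd_neg]
  simp

lemma time_lip {Ω : Set E2} (hopen : IsOpen Ω) {d A S : ℝ} (hd : 0 < d)
    {a : E2 → E2} (ha : ∀ x ∈ Ω, ∀ i, |a x i| ≤ A) {f : ℝ → ℝ} (hf : Continuous f)
    {u : E2 → ℝ → ℝ} (h : OneSol Ω d a f u)
    (hS : ∀ x ∈ closure Ω, ∀ t ∈ Set.Icc (0:ℝ) 1, u x t ≤ S)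
    {t0 : ℝ} (ht0 : 0 < t0) {K : Set E2} (hK : IsCompact K) (hKΩ : K ⊆ Ω) :
    ∃ C, ∀ x ∈ K, ∀ t ∈ Set.Icc t0 1, |u x t - u x t0| ≤ C * (t - t0) := by
  obtain ⟨M, hM⟩ := (isCompact_Icc (a := (0:ℝ)) (b := S)).exists_bound_of_continuousOn hf.continuousOn
  have hSabs : ∀ x ∈ closure Ω, ∀ t ∈ Set.Icc (0:ℝ) 1, |u x t| ≤ S := by
    intro x hx t ht
    rw [abs_of_nonneg (h.nonneg x hx t ht)]; exact hS x hx t ht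
  have hfM : ∀ x ∈ Ω, ∀ t ∈ Set.Ioc (0:ℝ) 1, |f (u x t)| ≤ M := by
    intro x hx t ht
    have ht' : t ∈ Set.Icc (0:ℝ) 1 := ⟨ht.1.le, ht.2⟩
    exact hM _ ⟨h.nonneg x (subset_closure hx) t ht', hS x (subset_closure hx) t ht'⟩
  obtain ⟨C1, hC1⟩ := time_lip_one hopen hd ha h.cont h.C2 h.C1 (M := M) (fun x hx t ht => by
    rw [h.pde x hx t ht]
    linarith [(abs_le.mp (hfM x hx t ht)).2]) hSabs ht0 hK hKΩ
  obtain ⟨C2, hC2⟩ := time_lip_one hopen hd ha (v := fun x t => - u x t) h.cont.neg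
    (fun t ht x hx => (h.C2 t ht x hx).neg) (fun x hx t ht => (h.C1 x hx t ht).neg)
    (M := M) (fun x hx t ht => by
    rw [deriv.fun_neg, h.pde x hx t ht, lap_neg]
    simp only [pd_neg]
    have := (abs_le.mp (hfM x hx t ht)).1
    simp only [mul_neg, Finset.sum_neg_distrib]
    linarith) (fun x hx t ht => by rw [abs_neg]; exact hSabs x hx t ht) ht0 hK hKΩ
  refine ⟨max C1 C2, fun x hx t ht => ?_⟩
  have h1 := hC1 x hx t ht
  have h2 := hC2 x hx t ht
  have h3 : 0 ≤ t - t0 := by linarith [ht.1]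
  have h4 := mul_le_mul_of_nonneg_right (le_max_left C1 C2) h3
  have h5 := mul_le_mul_of_nonneg_right (le_max_right C1 C2) h3
  rw [abs_le]
  constructor <;> linarith

lemma cube_lip {p q S : ℝ} (hp : 0 ≤ p) (hq : 0 ≤ q) (hpS : p ≤ S) (hqS : q ≤ S) :
    |p ^ 3 - q ^ 3| ≤ 3 * S ^ 2 * |p - q| := by
  have : p ^ 3 - q ^ 3 = (p ^ 2 + p * q + q ^ 2) * (p - q) := by ring
  rw [this, abs_mul, abs_of_nonneg (by positivity)]
  refine mul_le_mul_of_nonneg_right ?_ (abs_nonneg _)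
  nlinarith [mul_le_mul hpS hqS hq (hp.trans hpS), mul_le_mul hpS hpS hp (hp.trans hpS),
    mul_le_mul hqS hqS hq (hp.trans hpS)]

lemma sol_slice {Ω : Set E2} {d : ℝ} {a : E2 → E2} {f : ℝ → ℝ} {u : E2 → ℝ → ℝ}
    (h : OneSol Ω d a f u) {t : ℝ} (ht : t ∈ Set.Icc (0:ℝ) 1) :
    ContinuousOn (fun x => u x t) (closure Ω) :=
  h.cont.comp (by fun_prop : ContinuousOn (fun x : E2 => (x, t)) (closure Ω))
    (fun x hx => ⟨hx, ht⟩)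

lemma superlevel_compact {Ω : Set E2} (hopen : IsOpen Ω) (hb : Bornology.IsBounded Ω)
    {w : E2 → ℝ} (hw : ContinuousOn w (closure Ω)) (hbd : ∀ x ∈ frontier Ω, w x = 0)
    {ε : ℝ} (hε : 0 < ε) :
    IsCompact {x ∈ closure Ω | ε ≤ w x} ∧ {x ∈ closure Ω | ε ≤ w x} ⊆ Ω := by
  constructor
  · have h1 : IsClosed (closure Ω ∩ w ⁻¹' Set.Ici ε) :=
      hw.preimage_isClosed_of_isClosed isClosed_closure isClosed_Ici
    exact Metric.isCompact_of_isClosed_isBounded h1 (hb.closure.subset Set.inter_subset_left)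
  · rintro x ⟨hx, hxε⟩
    by_contra hn
    have : x ∈ frontier Ω := by rw [hopen.frontier_eq]; exact ⟨hx, hn⟩
    rw [hbd x this] at hxε
    linarith

lemma deriv_Phi {Ω : Set E2} (hopen : IsOpen Ω) (hb : Bornology.IsBounded Ω) {d A S : ℝ} (hd : 0 < d)
    {a : E2 → E2} (ha : ∀ x ∈ Ω, ∀ i, |a x i| ≤ A) {f : ℝ → ℝ} (hf : Continuous f)
    {u : E2 → ℝ → ℝ} (h : OneSol Ω d a f u) (hS0 : 0 ≤ S)
    (hS : ∀ x ∈ closure Ω, ∀ t ∈ Set.Icc (0:ℝ) 1, u x t ≤ S)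
    {t0 : ℝ} (ht0 : t0 ∈ Set.Ioo (0:ℝ) 1) {ε : ℝ} (hε : 0 < ε)
    {G : E2 → ℝ → ℝ} {Gt : E2 → ℝ} {Γ CG : ℝ} (hCG : 0 ≤ CG)
    (hGc : ∀ t ∈ Set.Icc (0:ℝ) 1, ContinuousOn (fun x => G x t) Ω)
    (hGb : ∀ x ∈ Ω, ∀ t ∈ Set.Icc (0:ℝ) 1, |G x t| ≤ Γ)
    (hGL : ∀ x ∈ Ω, ∀ t ∈ Set.Icc (0:ℝ) 1, |G x t - G x t0| ≤ CG * |t - t0|)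
    (hGt : ∀ x ∈ Ω, HasDerivAt (G x) (Gt x) t0) :
    HasDerivWithinAt (fun t => ∫ x in Ω, (max (u x t - ε) 0) ^ 3 * G x t)
      (∫ x in Ω, (3 * (max (u x t0 - ε) 0) ^ 2 * deriv (fun s => u x s) t0 * G x t0
        + (max (u x t0 - ε) 0) ^ 3 * Gt x)) (Set.Ici t0) t0 := by
  have ht0' : t0 ∈ Set.Icc (0:ℝ) 1 := ⟨ht0.1.le, ht0.2.le⟩
  have hfin : volume Ω < ⊤ := hb.measure_lt_top
  have : IsFiniteMeasure (volume.restrict Ω) := ⟨by simpa using hfin⟩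
  set H : E2 → ℝ → ℝ := fun x t => (max (u x t - ε) 0) ^ 3 * G x t with hH
  have hHc : ∀ t ∈ Set.Icc (0:ℝ) 1, ContinuousOn (fun x => H x t) Ω := by
    intro t ht
    have h1 : ContinuousOn (fun x => u x t) Ω := (sol_slice h ht).mono subset_closure
    exact (((h1.sub continuousOn_const).sup continuousOn_const).pow 3).mul (hGc t ht)
  have hq0 : ∀ x t, 0 ≤ max (u x t - ε) 0 := fun x t => le_max_right _ _
  have hqS : ∀ x ∈ Ω, ∀ t ∈ Set.Icc (0:ℝ) 1, max (u x t - ε) 0 ≤ S := fun x hx t ht =>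
    max_le (by linarith [hS x (subset_closure hx) t ht]) hS0
  have hHi : ∀ t ∈ Set.Icc (0:ℝ) 1, Integrable (fun x => H x t) (volume.restrict Ω) := by
    intro t ht
    refine Integrable.of_bound ((hHc t ht).aestronglyMeasurable hopen.measurableSet) (S ^ 3 * Γ) ?_
    rw [ae_restrict_iff' hopen.measurableSet]
    refine ae_of_all _ fun x hx => ?_
    rw [Real.norm_eq_abs, hH]
    simp only
    rw [abs_mul, abs_of_nonneg (pow_nonneg (hq0 x t) 3)]
    exact mul_le_mul (pow_le_pow_left₀ (hq0 x t) (hqS x hx t ht) 3) (hGb x hx t ht) (abs_nonneg _)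
      (by positivity)
  rw [← hasDerivWithinAt_Ioi_iff_Ici, hasDerivWithinAt_iff_tendsto_slope' (by simp)]
  have hIoo : ∀ᶠ t in 𝓝[>] t0, t ∈ Set.Ioo t0 1 := Ioo_mem_nhdsGT ht0.2
  obtain ⟨hKc, hKΩ⟩ := superlevel_compact hopen hb (sol_slice h ht0')
    (fun x hx => h.bdry x hx t0 ht0') (half_pos hε)
  set K := {x ∈ closure Ω | ε / 2 ≤ u x t0} with hK
  obtain ⟨C, hC⟩ := time_lip hopen hd ha hf h hS ht0.1 hKc hKΩ
  have hcomp : IsCompact (closure Ω ×ˢ Set.Icc (0:ℝ) 1) :=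
    (Metric.isCompact_of_isClosed_isBounded isClosed_closure hb.closure).prod isCompact_Icc
  have huc := hcomp.uniformContinuousOn_of_continuous h.cont
  rw [Metric.uniformContinuousOn_iff] at huc
  obtain ⟨δ, hδ, hδu⟩ := huc (ε / 2) (half_pos hε)
  have hnear : ∀ᶠ t in 𝓝[>] t0, t ∈ Set.Ioo t0 1 ∧ dist t t0 < δ := by
    refine Filter.Eventually.and hIoo ?_
    exact mem_nhdsWithin_of_mem_nhds (Metric.ball_mem_nhds t0 hδ)
  have hmain : Tendsto (fun t => ∫ x in Ω, slope (H x) t0 t) (𝓝[>] t0)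
      (𝓝 (∫ x in Ω, (3 * (max (u x t0 - ε) 0) ^ 2 * deriv (fun s => u x s) t0 * G x t0
        + (max (u x t0 - ε) 0) ^ 3 * Gt x))) := by
    refine tendsto_integral_filter_of_dominated_convergence
      (fun _ => 3 * S ^ 2 * |C| * |Γ| + S ^ 3 * CG) ?_ ?_ (integrable_const _) ?_
    · filter_upwards [hnear] with t ht
      have ht' : t ∈ Set.Icc (0:ℝ) 1 := ⟨ht0.1.le.trans ht.1.1.le, ht.1.2.le⟩
      refine ContinuousOn.aestronglyMeasurable ?_ hopen.measurableSet
      simp only [slope_def_field]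
      exact ((hHc t ht').sub (hHc t0 ht0')).div_const _
    · filter_upwards [hnear] with t ht
      have ht' : t ∈ Set.Icc (0:ℝ) 1 := ⟨ht0.1.le.trans ht.1.1.le, ht.1.2.le⟩
      have hpos : 0 < t - t0 := by linarith [ht.1.1]
      rw [ae_restrict_iff' hopen.measurableSet]
      refine ae_of_all _ fun x hx => ?_
      have hxc := subset_closure hx
      rw [slope_def_field, Real.norm_eq_abs, abs_div, abs_of_pos hpos, div_le_iff₀ hpos]
      by_cases hxK : x ∈ K
      · have e1 := hC x hxK t ⟨ht.1.1.le, ht.1.2.le⟩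
        have e2 : |max (u x t - ε) 0 - max (u x t0 - ε) 0| ≤ |C| * (t - t0) := by
          refine (abs_max_sub_max_le_abs _ _ _).trans ?_
          rw [sub_sub_sub_cancel_right]
          exact e1.trans (mul_le_mul_of_nonneg_right (le_abs_self C) hpos.le)
        have e3 := cube_lip (hq0 x t) (hq0 x t0) (hqS x hx t ht') (hqS x hx t0 ht0')
        have e4 : |max (u x t - ε) 0 ^ 3 - max (u x t0 - ε) 0 ^ 3| ≤ 3 * S ^ 2 * (|C| * (t - t0)) :=
          e3.trans (mul_le_mul_of_nonneg_left e2 (by positivity))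
        have e5 := (hGb x hx t ht').trans (le_abs_self Γ)
        have e6 := hGL x hx t ht'
        rw [abs_of_pos hpos] at e6
        have e7 : H x t - H x t0 = (max (u x t - ε) 0 ^ 3 - max (u x t0 - ε) 0 ^ 3) * G x t
            + max (u x t0 - ε) 0 ^ 3 * (G x t - G x t0) := by simp only [hH]; ring
        rw [e7]
        refine (abs_add_le _ _).trans ?_
        rw [abs_mul, abs_mul, abs_of_nonneg (pow_nonneg (hq0 x t0) 3)]
        have e8 := mul_le_mul e4 e5 (abs_nonneg _) (by positivity)
        have e9 := mul_le_mul (pow_le_pow_left₀ (hq0 x t0) (hqS x hx t0 ht0') 3) e6 (abs_nonneg _)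
          (by positivity)
        calc _ ≤ _ := add_le_add e8 e9
          _ = _ := by ring
      · have e1 : u x t0 < ε / 2 := by
          by_contra! hcon
          exact hxK ⟨hxc, hcon⟩
        have e2 := hδu (x, t) ⟨hxc, ht'⟩ (x, t0) ⟨hxc, ht0'⟩ (by
          rw [Prod.dist_eq]; simp [ht.2])
        simp only [Real.dist_eq] at e2
        have e3 := (abs_lt.mp e2).2
        have e4 : H x t = 0 := by
          simp only [hH]; rw [max_eq_right (by linarith)]; simp
        have e5 : H x t0 = 0 := by
          simp only [hH]; rw [max_eq_right (by linarith)]; simp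
        rw [e4, e5, sub_zero, abs_zero]
        positivity
    · rw [ae_restrict_iff' hopen.measurableSet]
      refine ae_of_all _ fun x hx => ?_
      have e1 := (h.C1 x hx t0 ⟨ht0.1, ht0.2.le⟩).hasDerivAt
      have e2 := (hasDerivAt_max_pow 3 (by norm_num) (u x t0 - ε)).comp t0 (e1.sub_const ε)
      have e3 : HasDerivAt (H x) _ t0 := e2.mul (hGt x hx)
      have e4 := (hasDerivAt_iff_tendsto_slope.mp e3).mono_left
        (nhdsWithin_mono t0 (fun y (hy : t0 < y) => ne_of_gt hy) : 𝓝[Set.Ioi t0] t0 ≤ _)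
      convert e4 using 2
      all_goals norm_num
  refine hmain.congr' ?_
  filter_upwards [hnear] with t ht
  have ht' : t ∈ Set.Icc (0:ℝ) 1 := ⟨ht0.1.le.trans ht.1.1.le, ht.1.2.le⟩
  simp only [slope_def_field]
  rw [integral_div, integral_sub (hHi t ht') (hHi t0 ht0')]

lemma pd_mul {v b : E2 → ℝ} {x : E2} (hv : DifferentiableAt ℝ v x) (hb : DifferentiableAt ℝ b x)
    (i : Fin 2) : pd (fun y => v y * b y) i x = v x * pd b i x + b x * pd v i x := by
  simp only [pd]
  rw [fderiv_fun_mul hv hb]; rfl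

lemma pd_const_mul {v : E2 → ℝ} {x : E2} (hv : DifferentiableAt ℝ v x) (c : ℝ)
    (i : Fin 2) : pd (fun y => c * v y) i x = c * pd v i x := by
  simp only [pd]
  rw [fderiv_const_mul hv]; rfl

lemma pd_comp {w : E2 → ℝ} {φ : ℝ → ℝ} {φ' : ℝ} {x : E2} (hw : DifferentiableAt ℝ w x)
    (hφ : HasDerivAt φ φ' (w x)) (i : Fin 2) : pd (fun y => φ (w y)) i x = φ' * pd w i x := by
  simp only [pd]
  have := hφ.comp_hasFDerivAt x hw.hasFDerivAt
  rw [show (fun y => φ (w y)) = φ ∘ w from rfl, this.fderiv]; rfl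

lemma ext_zero {Ω : Set E2} (hopen : IsOpen Ω) {F : E2 → ℝ} {K : Set E2} (hK : IsCompact K)
    (hKΩ : K ⊆ Ω) (hF : ∀ x ∈ Ω, ContDiffAt ℝ 1 F x) (hF0 : ∀ x ∈ Ω, x ∉ K → F x = 0) :
    ContDiff ℝ 1 (Ω.indicator F) ∧ HasCompactSupport (Ω.indicator F) ∧
    (∀ i, ∀ x ∈ Ω, pd (Ω.indicator F) i x = pd F i x) ∧
    (∀ i, ∀ x ∉ Ω, pd (Ω.indicator F) i x = 0) := by
  have hin : ∀ x ∈ Ω, Ω.indicator F =ᶠ[𝓝 x] F := by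
    intro x hx
    filter_upwards [hopen.mem_nhds hx] with y hy
    exact Set.indicator_of_mem hy F
  have hz : ∀ x ∉ K, Ω.indicator F x = 0 := by
    intro x hx
    by_cases hxΩ : x ∈ Ω
    · rw [Set.indicator_of_mem hxΩ]; exact hF0 x hxΩ hx
    · exact Set.indicator_of_notMem hxΩ F
  have hout : ∀ x ∉ Ω, Ω.indicator F =ᶠ[𝓝 x] fun _ => 0 := by
    intro x hx
    filter_upwards [hK.isClosed.isOpen_compl.mem_nhds (fun h => hx (hKΩ h) : x ∈ Kᶜ)] with y hy
    exact hz y hy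
  refine ⟨?_, ?_, ?_, ?_⟩
  · rw [contDiff_iff_contDiffAt]
    intro x
    by_cases hx : x ∈ Ω
    · exact (hF x hx).congr_of_eventuallyEq (hin x hx)
    · exact contDiffAt_const.congr_of_eventuallyEq (hout x hx)
  · exact HasCompactSupport.intro hK hz
  · intro i x hx
    rw [pd, (hin x hx).fderiv_eq]; rfl
  · intro i x hx
    rw [pd, (hout x hx).fderiv_eq]; simp

lemma integral_pd_eq_zero {F : E2 → ℝ} (hF : ContDiff ℝ 1 F) (hc : HasCompactSupport F)
    (i : Fin 2) : Integrable (fun x => pd F i x) ∧ ∫ x, pd F i x = 0 := by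
  have hcont : Continuous (fun x => pd F i x) :=
    (hF.continuous_fderiv (by norm_num)).clm_apply continuous_const
  have hsupp : HasCompactSupport (fun x => pd F i x) := by
    have := hc.fderiv ℝ
    exact this.comp_left (g := fun L : E2 →L[ℝ] ℝ => L (EuclideanSpace.single i 1)) rfl
  have hint := hcont.integrable_of_hasCompactSupport hsupp (μ := volume)
  refine ⟨hint, ?_⟩
  have := integral_mul_fderiv_eq_neg_fderiv_mul_of_integrable (μ := (volume : Measure E2))
    (f := fun _ : E2 => (1:ℝ)) (g := F) (v := EuclideanSpace.single i 1) (by simp)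
    (by simpa [pd] using hint) (by simpa using hF.continuous.integrable_of_hasCompactSupport hc)
    (fun x _ => by fun_prop) (fun x _ => hF.contDiffAt.differentiableAt (by norm_num))
  simpa [pd] using this

lemma setIntegral_pd_eq_zero {Ω : Set E2} (hopen : IsOpen Ω) {F : E2 → ℝ} {K : Set E2}
    (hK : IsCompact K)
    (hKΩ : K ⊆ Ω) (hF : ∀ x ∈ Ω, ContDiffAt ℝ 1 F x) (hF0 : ∀ x ∈ Ω, x ∉ K → F x = 0) (i : Fin 2) :
    IntegrableOn (fun x => pd F i x) Ω ∧ ∫ x in Ω, pd F i x = 0 := by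
  obtain ⟨h1, h2, h3, h4⟩ := ext_zero hopen hK hKΩ hF hF0
  obtain ⟨h5, h6⟩ := integral_pd_eq_zero h1 h2 i
  constructor
  · exact h5.integrableOn.congr_fun (fun x hx => h3 i x hx) hopen.measurableSet
  · rw [← h6, ← setIntegral_eq_integral_of_forall_compl_eq_zero (h4 i)]
    exact setIntegral_congr_fun hopen.measurableSet (fun x hx => (h3 i x hx).symm)

lemma integrableOn_of_zero_off {Ω : Set E2} (hopen : IsOpen Ω) {F : E2 → ℝ} {K : Set E2}
    (hK : IsCompact K) (hKΩ : K ⊆ Ω) (hF : ContinuousOn F Ω) (hF0 : ∀ x ∈ Ω, x ∉ K → F x = 0) :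
    IntegrableOn F Ω :=
  ((hF.mono hKΩ).integrableOn_compact hK).of_forall_sdiff_eq_zero hopen.measurableSet
    (fun x hx => hF0 x hx.1 hx.2)

lemma contDiff_max_pow (n : ℕ) (hn : 2 ≤ n) : ContDiff ℝ 1 (fun s : ℝ => (max s 0) ^ n) := by
  rw [contDiff_one_iff_deriv]
  refine ⟨fun s => (hasDerivAt_max_pow n hn s).differentiableAt, ?_⟩
  have : deriv (fun s : ℝ => (max s 0) ^ n) = fun s : ℝ => (n:ℝ) * (max s 0) ^ (n - 1) := by
    funext s; exact (hasDerivAt_max_pow n hn s).deriv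
  rw [this]; fun_prop

lemma spatial_ibp {Ω : Set E2} (hopen : IsOpen Ω) (hb : Bornology.IsBounded Ω) {d ε : ℝ} (hε : 0 < ε)
    {a : E2 → E2} (ha : ContDiffOn ℝ 1 a (closure Ω))
    (hdiv : ∀ x ∈ Ω, (∑ i, pd (fun y => a y i) i x) = 0)
    {w : E2 → ℝ} (hwc : ContinuousOn w (closure Ω)) (hbd : ∀ x ∈ frontier Ω, w x = 0)
    (hw : ∀ x ∈ Ω, ContDiffAt ℝ 2 w x) {G : E2 → ℝ} (hG : ContDiff ℝ 2 G) :
    IntegrableOn (fun x => 6 * d * max (w x - ε) 0 * (∑ i, (pd w i x) ^ 2) * G x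
      + 3 * (max (w x - ε) 0) ^ 2 * (d * lap w x - ∑ i, a x i * pd w i x) * G x
      - (max (w x - ε) 0) ^ 3 * (d * lap G x + ∑ i, a x i * pd G i x)) Ω ∧
    ∫ x in Ω, (6 * d * max (w x - ε) 0 * (∑ i, (pd w i x) ^ 2) * G x
      + 3 * (max (w x - ε) 0) ^ 2 * (d * lap w x - ∑ i, a x i * pd w i x) * G x
      - (max (w x - ε) 0) ^ 3 * (d * lap G x + ∑ i, a x i * pd G i x)) = 0 := by
  obtain ⟨hK, hKΩ⟩ := superlevel_compact hopen hb hwc hbd hε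
  set K := {x ∈ closure Ω | ε ≤ w x} with hKdef
  let F : Fin 2 → E2 → ℝ := fun i y =>
    d * ((3 * (max (w y - ε) 0) ^ 2) * (pd w i y * G y) - (max (w y - ε) 0) ^ 3 * pd G i y)
      - (max (w y - ε) 0) ^ 3 * (a y i * G y)
  have hq : ∀ x ∈ Ω, ∀ n, 2 ≤ n → ContDiffAt ℝ 1 (fun y => (max (w y - ε) 0) ^ n) x := by
    intro x hx n hn
    exact (contDiff_max_pow n hn).contDiffAt.comp x
      (((hw x hx).of_le (by norm_num)).sub contDiffAt_const)
  have hai : ∀ x ∈ Ω, ∀ i, ContDiffAt ℝ 1 (fun y => a y i) x := by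
    intro x hx i
    have h1 : ContDiffAt ℝ 1 a x := ha.contDiffAt (mem_of_superset (hopen.mem_nhds hx) subset_closure)
    exact (EuclideanSpace.proj i : E2 →L[ℝ] ℝ).contDiff.contDiffAt.comp x h1
  have hpw : ∀ x ∈ Ω, ∀ i, ContDiffAt ℝ 1 (pd w i) x := fun x hx i => contDiffAt_pd (hw x hx) i
  have hpG : ∀ x, ∀ i, ContDiffAt ℝ 1 (pd G i) x := fun x i => contDiffAt_pd hG.contDiffAt i
  have hG1 : ∀ x, ContDiffAt ℝ 1 G x := fun x => hG.contDiffAt.of_le (by norm_num)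
  have hF : ∀ i, ∀ x ∈ Ω, ContDiffAt ℝ 1 (F i) x := by
    intro i x hx
    have h2 := hq x hx 2 le_rfl
    have h3 := hq x hx 3 (by norm_num)
    exact (contDiffAt_const.mul (((contDiffAt_const.mul h2).mul ((hpw x hx i).mul (hG1 x))).sub
      (h3.mul (hpG x i)))).sub (h3.mul ((hai x hx i).mul (hG1 x)))
  have hqz : ∀ x ∈ Ω, x ∉ K → max (w x - ε) 0 = 0 := by
    intro x hx hxK
    have : w x < ε := by
      by_contra! hcon
      exact hxK ⟨subset_closure hx, hcon⟩
    exact max_eq_right (by linarith)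
  have hF0 : ∀ i, ∀ x ∈ Ω, x ∉ K → F i x = 0 := by
    intro i x hx hxK
    simp [F, hqz x hx hxK]
  have hI := fun i => setIntegral_pd_eq_zero hopen hK hKΩ (hF i) (hF0 i) i
  have hpdF : ∀ i, ∀ x ∈ Ω, pd (F i) i x =
      6 * d * max (w x - ε) 0 * (pd w i x) ^ 2 * G x
      + 3 * (max (w x - ε) 0) ^ 2 * (d * pd2 w i i x - a x i * pd w i x) * G x
      - (max (w x - ε) 0) ^ 3 * (d * pd2 G i i x + a x i * pd G i x)
      - (max (w x - ε) 0) ^ 3 * G x * pd (fun y => a y i) i x := by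
    intro i x hx
    have n1 : (1 : WithTop ℕ∞) ≠ 0 := by norm_num
    have dq2 := (hq x hx 2 le_rfl).differentiableAt n1
    have dq3 := (hq x hx 3 (by norm_num)).differentiableAt n1
    have da := (hai x hx i).differentiableAt n1
    have dpw := (hpw x hx i).differentiableAt n1
    have dpG := (hpG x i).differentiableAt n1
    have dG := (hG1 x).differentiableAt n1
    have dw := (hw x hx).differentiableAt (by norm_num)
    have e2 : pd (fun y => (max (w y - ε) 0) ^ 2) i x = 2 * max (w x - ε) 0 * pd w i x := by
      have := pd_comp (φ := fun s => (max (s - ε) 0) ^ 2) dw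
        ((hasDerivAt_max_pow 2 le_rfl (w x - ε)).comp_sub_const (w x) ε) i
      rw [this]; norm_num
    have e3 : pd (fun y => (max (w y - ε) 0) ^ 3) i x = 3 * max (w x - ε) 0 ^ 2 * pd w i x := by
      have := pd_comp (φ := fun s => (max (s - ε) 0) ^ 3) dw
        ((hasDerivAt_max_pow 3 (by norm_num) (w x - ε)).comp_sub_const (w x) ε) i
      rw [this]; norm_num
    simp only [F]
    have d1 : DifferentiableAt ℝ (fun y => 3 * (max (w y - ε) 0) ^ 2) x := dq2.const_mul 3
    have d2 : DifferentiableAt ℝ (fun y => pd w i y * G y) x := dpw.mul dG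
    have d3 : DifferentiableAt ℝ (fun y => (3 * (max (w y - ε) 0) ^ 2) * (pd w i y * G y)) x := d1.mul d2
    have d4 : DifferentiableAt ℝ (fun y => (max (w y - ε) 0) ^ 3 * pd G i y) x := dq3.mul dpG
    have d5 : DifferentiableAt ℝ (fun y => (3 * (max (w y - ε) 0) ^ 2) * (pd w i y * G y)
      - (max (w y - ε) 0) ^ 3 * pd G i y) x := d3.sub d4
    have d6 : DifferentiableAt ℝ (fun y => d * ((3 * (max (w y - ε) 0) ^ 2) * (pd w i y * G y)
      - (max (w y - ε) 0) ^ 3 * pd G i y)) x := d5.const_mul d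
    have d7 : DifferentiableAt ℝ (fun y => a y i * G y) x := da.mul dG
    have d8 : DifferentiableAt ℝ (fun y => (max (w y - ε) 0) ^ 3 * (a y i * G y)) x := dq3.mul d7
    rw [pd_sub d6 d8, pd_const_mul d5, pd_sub d3 d4, pd_mul d1 d2, pd_mul dq3 dpG, pd_mul dpw dG,
      pd_mul dq3 d7, pd_mul da dG, pd_const_mul dq2, e2, e3]
    simp only [pd2]
    ring
  have hsum : ∀ x ∈ Ω, pd (F 0) 0 x + pd (F 1) 1 x =
      6 * d * max (w x - ε) 0 * (∑ i, (pd w i x) ^ 2) * G x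
      + 3 * (max (w x - ε) 0) ^ 2 * (d * lap w x - ∑ i, a x i * pd w i x) * G x
      - (max (w x - ε) 0) ^ 3 * (d * lap G x + ∑ i, a x i * pd G i x) := by
    intro x hx
    have := hdiv x hx
    simp only [lap, Fin.sum_univ_two] at this ⊢
    rw [hpdF 0 x hx, hpdF 1 x hx]
    linear_combination (-(max (w x - ε) 0) ^ 3 * G x) * this
  constructor
  · exact ((hI 0).1.add (hI 1).1).congr_fun (fun x hx => hsum x hx) hopen.measurableSet
  · rw [← setIntegral_congr_fun hopen.measurableSet (fun x hx => hsum x hx),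
      integral_add (hI 0).1 (hI 1).1, (hI 0).2, (hI 1).2, add_zero]

lemma energy_deriv {Ω : Set E2} (hopen : IsOpen Ω) (hb : Bornology.IsBounded Ω) {d A S r : ℝ} (hd : 0 < d)
    {a : E2 → E2} (ha : ∀ x ∈ Ω, ∀ i, |a x i| ≤ A) (haC : ContDiffOn ℝ 1 a (closure Ω))
    (hdiv : ∀ x ∈ Ω, (∑ i, pd (fun y => a y i) i x) = 0)
    {f : ℝ → ℝ} (hf : Continuous f) (hfr : ∀ s, 0 ≤ s → f s ≤ r * s)
    {u : E2 → ℝ → ℝ} (h : OneSol Ω d a f u) (hS0 : 0 ≤ S)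
    (hS : ∀ x ∈ closure Ω, ∀ t ∈ Set.Icc (0:ℝ) 1, u x t ≤ S)
    {t0 : ℝ} (ht0 : t0 ∈ Set.Ioo (0:ℝ) 1) {ε : ℝ} (hε : 0 < ε)
    {G : E2 → ℝ → ℝ} {Gt : E2 → ℝ} {Γ CG : ℝ} (hCG : 0 ≤ CG)
    (hG2 : ∀ t ∈ Set.Icc (0:ℝ) 1, ContDiff ℝ 2 (fun x => G x t))
    (hG0 : ∀ x, 0 ≤ G x t0) (hGtc : Continuous Gt)
    (hGb : ∀ x ∈ Ω, ∀ t ∈ Set.Icc (0:ℝ) 1, |G x t| ≤ Γ)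
    (hGL : ∀ x ∈ Ω, ∀ t ∈ Set.Icc (0:ℝ) 1, |G x t - G x t0| ≤ CG * |t - t0|)
    (hGt : ∀ x ∈ Ω, HasDerivAt (G x) (Gt x) t0) :
    ∃ D, HasDerivWithinAt (fun t => ∫ x in Ω, (max (u x t - ε) 0) ^ 3 * G x t) D (Set.Ici t0) t0 ∧
      IntegrableOn (fun x => (max (u x t0 - ε) 0) ^ 3 * (d * lap (fun y => G y t0) x
        + (∑ i, a x i * pd (fun y => G y t0) i x) + Gt x + 3 * r * G x t0)
        + 3 * |r| * ε * (max (u x t0 - ε) 0) ^ 2 * G x t0) Ω ∧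
      D ≤ - (∫ x in Ω, 6 * d * max (u x t0 - ε) 0 * (∑ i, (pd (fun y => u y t0) i x) ^ 2) * G x t0)
       + ∫ x in Ω, ((max (u x t0 - ε) 0) ^ 3 * (d * lap (fun y => G y t0) x
        + (∑ i, a x i * pd (fun y => G y t0) i x) + Gt x + 3 * r * G x t0)
        + 3 * |r| * ε * (max (u x t0 - ε) 0) ^ 2 * G x t0) := by
  have ht0' : t0 ∈ Set.Icc (0:ℝ) 1 := ⟨ht0.1.le, ht0.2.le⟩
  have ht0c : t0 ∈ Set.Ioc (0:ℝ) 1 := ⟨ht0.1, ht0.2.le⟩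
  set w : E2 → ℝ := fun y => u y t0 with hwdef
  set g : E2 → ℝ := fun y => G y t0 with hgdef
  have hwc : ContinuousOn w (closure Ω) := sol_slice h ht0'
  have hbd : ∀ x ∈ frontier Ω, w x = 0 := fun x hx => h.bdry x hx t0 ht0'
  have hw : ∀ x ∈ Ω, ContDiffAt ℝ 2 w x := h.C2 t0 ht0c
  have hg2 : ContDiff ℝ 2 g := hG2 t0 ht0'
  obtain ⟨hi, hz⟩ := spatial_ibp hopen hb (d := d) hε haC hdiv hwc hbd hw hg2
  obtain ⟨hK, hKΩ⟩ := superlevel_compact hopen hb hwc hbd hε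
  set K := {x ∈ closure Ω | ε ≤ w x} with hKdef
  have hqz : ∀ x ∈ Ω, x ∉ K → max (w x - ε) 0 = 0 := by
    intro x hx hxK
    have : w x < ε := by
      by_contra! hcon
      exact hxK ⟨subset_closure hx, hcon⟩
    exact max_eq_right (by linarith)
  have cw : ContinuousOn w Ω := hwc.mono subset_closure
  have cq : ContinuousOn (fun x => max (w x - ε) 0) Ω := (cw.sub continuousOn_const).sup continuousOn_const
  have cg : ContinuousOn g Ω := hg2.continuous.continuousOn
  have cpw : ∀ i, ContinuousOn (fun x => pd w i x) Ω := fun i x hx =>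
    (contDiffAt_pd (hw x hx) i).continuousAt.continuousWithinAt
  have cpg : ∀ i, ContinuousOn (fun x => pd g i x) Ω := fun i x hx =>
    (contDiffAt_pd hg2.contDiffAt i).continuousAt.continuousWithinAt
  have clg : ContinuousOn (fun x => lap g x) Ω := by
    intro x hx
    have : ∀ i, ContinuousAt (fun y => pd2 g i i y) x := by
      intro i
      have h1 : ContDiff ℝ 1 (fun y => pd g i y) := contDiff_iff_contDiffAt.2
        (fun y => contDiffAt_pd hg2.contDiffAt i)
      exact ((h1.continuous_fderiv (by norm_num)).clm_apply continuous_const).continuousAt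
    have h2 : ContinuousAt (fun x => lap g x) x := tendsto_finsetSum _ (fun i _ => this i)
    exact h2.continuousWithinAt
  have ca : ∀ i, ContinuousOn (fun x => a x i) Ω := fun i =>
    ((EuclideanSpace.proj i : E2 →L[ℝ] ℝ).continuous.comp_continuousOn (haC.continuousOn)).mono subset_closure
  have cGt : ContinuousOn Gt Ω := hGtc.continuousOn
  have cfw : ContinuousOn (fun x => f (w x)) Ω := hf.comp_continuousOn cw
  have csw : ContinuousOn (fun x => ∑ i, (pd w i x) ^ 2) Ω :=
    continuousOn_finsetSum _ (fun i _ => (cpw i).pow 2)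
  have csg : ContinuousOn (fun x => ∑ i, a x i * pd g i x) Ω :=
    continuousOn_finsetSum _ (fun i _ => (ca i).mul (cpg i))
  have iI0 : IntegrableOn (fun x => 6 * d * max (w x - ε) 0 * (∑ i, (pd w i x) ^ 2) * g x) Ω := by
    refine integrableOn_of_zero_off hopen hK hKΩ ?_ ?_
    · exact ((continuousOn_const.mul cq).mul csw).mul cg
    · intro x hx hxK; simp [hqz x hx hxK]
  have iJ : IntegrableOn (fun x => (max (w x - ε) 0) ^ 3 * (d * lap g x + ∑ i, a x i * pd g i x)
      + 3 * (max (w x - ε) 0) ^ 2 * f (w x) * g x + (max (w x - ε) 0) ^ 3 * Gt x) Ω := by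
    refine integrableOn_of_zero_off hopen hK hKΩ ?_ ?_
    · exact (((cq.pow 3).mul ((continuousOn_const.mul clg).add csg)).add
        (((continuousOn_const.mul (cq.pow 2)).mul cfw).mul cg)).add ((cq.pow 3).mul cGt)
    · intro x hx hxK; simp [hqz x hx hxK]
  have iJ' : IntegrableOn (fun x => (max (w x - ε) 0) ^ 3 * (d * lap g x
        + (∑ i, a x i * pd g i x) + Gt x + 3 * r * g x)
        + 3 * |r| * ε * (max (w x - ε) 0) ^ 2 * g x) Ω := by
    refine integrableOn_of_zero_off hopen hK hKΩ ?_ ?_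
    · exact ((cq.pow 3).mul ((((continuousOn_const.mul clg).add csg).add cGt).add
        (continuousOn_const.mul cg))).add ((continuousOn_const.mul (cq.pow 2)).mul cg)
    · intro x hx hxK; simp [hqz x hx hxK]
  have hD := deriv_Phi hopen hb hd ha hf h hS0 hS ht0 hε hCG
    (fun t ht => (hG2 t ht).continuous.continuousOn) hGb hGL hGt
  refine ⟨_, hD, iJ', ?_⟩
  have e1 : (∫ x in Ω, (3 * (max (u x t0 - ε) 0) ^ 2 * deriv (fun s => u x s) t0 * G x t0
        + (max (u x t0 - ε) 0) ^ 3 * Gt x)) =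
      ∫ x in Ω, ((6 * d * max (w x - ε) 0 * (∑ i, (pd w i x) ^ 2) * g x
      + 3 * (max (w x - ε) 0) ^ 2 * (d * lap w x - ∑ i, a x i * pd w i x) * g x
      - (max (w x - ε) 0) ^ 3 * (d * lap g x + ∑ i, a x i * pd g i x))
      + (-(6 * d * max (w x - ε) 0 * (∑ i, (pd w i x) ^ 2) * g x)
      + ((max (w x - ε) 0) ^ 3 * (d * lap g x + ∑ i, a x i * pd g i x)
      + 3 * (max (w x - ε) 0) ^ 2 * f (w x) * g x + (max (w x - ε) 0) ^ 3 * Gt x))) := by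
    refine setIntegral_congr_fun hopen.measurableSet (fun x hx => ?_)
    simp only
    rw [h.pde x hx t0 ht0c]
    simp only [hwdef, hgdef]
    ring
  have iN : IntegrableOn (fun x => -(6 * d * max (w x - ε) 0 * (∑ i, (pd w i x) ^ 2) * g x)) Ω := iI0.neg
  have iNJ : IntegrableOn (fun x => -(6 * d * max (w x - ε) 0 * (∑ i, (pd w i x) ^ 2) * g x)
      + ((max (w x - ε) 0) ^ 3 * (d * lap g x + ∑ i, a x i * pd g i x)
      + 3 * (max (w x - ε) 0) ^ 2 * f (w x) * g x + (max (w x - ε) 0) ^ 3 * Gt x)) Ω := iN.add iJ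
  rw [e1, integral_add hi iNJ, hz, zero_add, integral_add iN iJ, integral_neg]
  refine add_le_add le_rfl ?_
  refine setIntegral_mono_on iJ iJ' hopen.measurableSet (fun x hx => ?_)
  have hw0 : 0 ≤ w x := h.nonneg x (subset_closure hx) t0 ht0'
  have h1 := hfr (w x) hw0
  have h2 : (max (w x - ε) 0) ^ 2 * f (w x) ≤ r * (max (w x - ε) 0) ^ 3 + |r| * ε * (max (w x - ε) 0) ^ 2 := by
    rcases le_total (w x) ε with hle | hle
    · rw [max_eq_right (by linarith)]; simp
    · rw [max_eq_left (by linarith)]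
      have h3 : r * w x ≤ r * (w x - ε) + |r| * ε := by
        nlinarith [le_abs_self r]
      nlinarith [mul_le_mul_of_nonneg_left (h1.trans h3) (sq_nonneg (w x - ε))]
  have h3 := mul_le_mul_of_nonneg_right h2 (hG0 x)
  simp only [hgdef] at h3 ⊢
  nlinarith [h3]

lemma one_dim {φ : ℝ → ℝ} (hφ : ContDiff ℝ 1 φ) (hc : HasCompactSupport φ) (x : ℝ) :
    2 * |φ x| ≤ ∫ s, |deriv φ s| := by
  have hi : Integrable (deriv φ) :=
    (hφ.continuous_deriv le_rfl).integrable_of_hasCompactSupport hc.deriv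
  have h1 := hc.integral_Iic_deriv_eq hφ x
  have h2 := hc.integral_Ioi_deriv_eq hφ x
  have h3 : |φ x| ≤ ∫ s in Set.Iic x, |deriv φ s| := by
    rw [← h1]; exact abs_integral_le_integral_abs
  have h4 : |φ x| ≤ ∫ s in Set.Ioi x, |deriv φ s| := by
    rw [← abs_neg, ← h2]; exact abs_integral_le_integral_abs
  have h5 := integral_add_compl (measurableSet_Iic (a := x)) hi.abs
  rw [Set.compl_Iic] at h5
  linarith

def eT (p : ℝ × ℝ) : E2 := WithLp.toLp 2 ![p.1, p.2]

lemma eT_mp : MeasurePreserving eT := by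
  have h1 := (PiLp.volume_preserving_toLp (Fin 2)).comp (volume_preserving_finTwoArrow ℝ).symm
  exact h1

lemma eT_emb : MeasurableEmbedding eT := by
  have h1 := (MeasurableEquiv.toLp 2 (Fin 2 → ℝ)).measurableEmbedding.comp
    (MeasurableEquiv.finTwoArrow (α := ℝ)).symm.measurableEmbedding
  exact h1

lemma eT_cont : Continuous eT := by
  unfold eT
  refine (PiLp.continuous_toLp 2 _).comp ?_
  refine continuous_pi fun i => ?_
  fin_cases i
  · exact continuous_fst
  · exact continuous_snd

lemma eT_0 (s y : ℝ) : eT (s, y) = eT (0, y) + s • EuclideanSpace.single 0 1 := by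
  ext i; fin_cases i <;> simp [eT]

lemma eT_1 (x s : ℝ) : eT (x, s) = eT (x, 0) + s • EuclideanSpace.single 1 1 := by
  ext i; fin_cases i <;> simp [eT]

lemma line_sobolev {W : E2 → ℝ} (hW : ContDiff ℝ 1 W) (hc : HasCompactSupport W) (x : E2) (i : Fin 2)
    (s : ℝ) : 2 * |W (x + s • EuclideanSpace.single i 1)|
      ≤ ∫ s : ℝ, |pd W i (x + s • EuclideanSpace.single i 1)| := by
  have hφ : ContDiff ℝ 1 (fun s : ℝ => W (x + s • EuclideanSpace.single i 1)) := by fun_prop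
  have hcφ : HasCompactSupport (fun s : ℝ => W (x + s • EuclideanSpace.single i 1)) := by
    refine hc.comp_isClosedEmbedding (g := fun s : ℝ => x + s • EuclideanSpace.single i (1:ℝ)) ?_
    refine (Homeomorph.addLeft x).isClosedEmbedding.comp ?_
    exact isClosedEmbedding_smul_left (by simp)
  have := one_dim hφ hcφ s
  refine this.trans (le_of_eq ?_)
  refine integral_congr_ae (ae_of_all _ fun s => ?_)
  simp only
  rw [(line_hasDerivAt (hW.contDiffAt.differentiableAt (by norm_num))).deriv]; rfl

lemma ladyz {W : E2 → ℝ} (hW : ContDiff ℝ 1 W) (hc : HasCompactSupport W) :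
    Integrable (fun x => W x ^ 2) ∧ 
    4 * ∫ x, W x ^ 2 ≤ (∫ x, |pd W 0 x|) * ∫ x, |pd W 1 x| := by
  have hpi : ∀ i, Integrable (fun x => pd W i x) := fun i => (integral_pd_eq_zero hW hc i).1
  have hW2 : Integrable (fun x => W x ^ 2) := by
    have h1 : HasCompactSupport (fun x => W x ^ 2) :=
      HasCompactSupport.comp_left (g := fun s : ℝ => s ^ 2) hc (by norm_num)
    have h2 : Continuous (fun x => W x ^ 2) := hW.continuous.pow 2
    exact h2.integrable_of_hasCompactSupport h1
  refine ⟨hW2, ?_⟩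
  have tr : ∀ F : E2 → ℝ, ∫ x, F x = ∫ p : ℝ × ℝ, F (eT p) := fun F =>
    (eT_mp.integral_comp eT_emb F).symm
  have tri : ∀ F : E2 → ℝ, Integrable F → Integrable (fun p : ℝ × ℝ => F (eT p)) (volume.prod volume) :=
    fun F hF => (eT_mp.integrable_comp_emb eT_emb).2 hF
  set A : ℝ → ℝ := fun x => ∫ s, |pd W 1 (eT (x, s))| with hA
  set B : ℝ → ℝ := fun y => ∫ s, |pd W 0 (eT (s, y))| with hB
  have i0 := tri _ (hpi 0).abs
  have i1 := tri _ (hpi 1).abs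
  have iA : Integrable A := i1.integral_prod_left
  have iB : Integrable B := i0.integral_prod_right
  have eA : ∫ x, |pd W 1 x| = ∫ x, A x := by
    rw [tr]; exact integral_prod _ i1
  have eB : ∫ x, |pd W 0 x| = ∫ y, B y := by
    rw [tr]; exact integral_prod_symm _ i0
  rw [eA, eB, mul_comm (∫ y, B y), ← integral_prod_mul, tr, ← integral_const_mul]
  refine integral_mono ((tri _ hW2).const_mul 4) (iA.mul_prod iB) ?_
  rintro ⟨x, y⟩
  simp only
  have h1 : 2 * |W (eT (x, y))| ≤ A x := by
    have := line_sobolev hW hc (eT (x, 0)) 1 y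
    simpa only [hA, ← eT_1] using this
  have h2 : 2 * |W (eT (x, y))| ≤ B y := by
    have := line_sobolev hW hc (eT (0, y)) 0 x
    simpa only [hB, ← eT_0] using this
  have h3 := mul_le_mul h1 h2 (by positivity) (le_trans (by positivity) h1)
  calc 4 * W (eT (x, y)) ^ 2 = 2 * |W (eT (x, y))| * (2 * |W (eT (x, y))|) := by
        rw [← sq_abs]; ring
    _ ≤ _ := h3

lemma cs_vol {Ω : Set E2} (hb : Bornology.IsBounded Ω) {p : E2 → ℝ}
    (hp : IntegrableOn p Ω) (hp2 : IntegrableOn (fun x => p x ^ 2) Ω) :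
    (∫ x in Ω, |p x|) ^ 2 ≤ (volume Ω).toReal * ∫ x in Ω, p x ^ 2 := by
  have hfin : volume Ω < ⊤ := hb.measure_lt_top
  have : IsFiniteMeasure (volume.restrict Ω) := ⟨by simpa using hfin⟩
  have key : ∀ c : ℝ, 0 ≤ (volume Ω).toReal * (c * c) + (- 2 * ∫ x in Ω, |p x|) * c + ∫ x in Ω, p x ^ 2 := by
    intro c
    have h1 : ∫ x in Ω, ((|p x| - c) ^ 2) = ∫ x in Ω, (p x ^ 2 + (-2 * c * |p x| + c * c)) := by
      refine integral_congr_ae (ae_of_all _ fun x => ?_)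
      simp only
      rw [← sq_abs (p x)]; ring
    have h0 : 0 ≤ ∫ x in Ω, ((|p x| - c) ^ 2) := integral_nonneg fun x => sq_nonneg _
    have ia : IntegrableOn (fun x => -2 * c * |p x|) Ω := hp.abs.const_mul _
    have ic : IntegrableOn (fun _ : E2 => c * c) Ω := integrable_const _
    have iac : IntegrableOn (fun x => -2 * c * |p x| + c * c) Ω := ia.add ic
    rw [h1, integral_add hp2 iac, integral_add ia ic, integral_const_mul, setIntegral_const] at h0
    simp only [smul_eq_mul, Measure.real] at h0
    linarith
  have := discrim_le_zero key
  unfold discrim at this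
  nlinarith

lemma poincare {Ω : Set E2} (hopen : IsOpen Ω) (hb : Bornology.IsBounded Ω) {W : E2 → ℝ} (hW : ContDiff ℝ 1 W)
    (hc : HasCompactSupport W) (h0 : ∀ i, ∀ x ∉ Ω, pd W i x = 0) (hW0 : ∀ x ∉ Ω, W x = 0) :
    ∫ x in Ω, W x ^ 2 ≤ (volume Ω).toReal / 8 * ∫ x in Ω, ∑ i, (pd W i x) ^ 2 := by
  obtain ⟨hi, hl⟩ := ladyz hW hc
  have hpi : ∀ i, Integrable (fun x => pd W i x) := fun i => (integral_pd_eq_zero hW hc i).1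
  have hp2 : ∀ i, Integrable (fun x => pd W i x ^ 2) := by
    intro i
    have hcont : Continuous (fun x => pd W i x) :=
      (hW.continuous_fderiv (by norm_num)).clm_apply continuous_const
    have h1 : HasCompactSupport (fun x => pd W i x ^ 2) :=
      HasCompactSupport.comp_left (f := fderiv ℝ W)
        (g := fun L : E2 →L[ℝ] ℝ => (L (EuclideanSpace.single i 1)) ^ 2) (hc.fderiv ℝ) (by simp)
    have h2 : Continuous (fun x => pd W i x ^ 2) := hcont.pow 2
    exact h2.integrable_of_hasCompactSupport h1
  have e0 : ∀ i, ∫ x, |pd W i x| = ∫ x in Ω, |pd W i x| := fun i =>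
    (setIntegral_eq_integral_of_forall_compl_eq_zero (fun x hx => by simp [h0 i x hx])).symm
  have e1 : ∫ x, W x ^ 2 = ∫ x in Ω, W x ^ 2 :=
    (setIntegral_eq_integral_of_forall_compl_eq_zero (fun x hx => by simp [hW0 x hx])).symm
  rw [e0, e0, e1] at hl
  have c0 := cs_vol hb (hpi 0).integrableOn (hp2 0).integrableOn
  have c1 := cs_vol hb (hpi 1).integrableOn (hp2 1).integrableOn
  simp only [Fin.sum_univ_two]
  rw [integral_add (hp2 0).integrableOn (hp2 1).integrableOn]
  nlinarith [sq_nonneg ((∫ x in Ω, |pd W 0 x|) - ∫ x in Ω, |pd W 1 x|)]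

lemma ode_le {Φ B B' : ℝ → ℝ} {t1 : ℝ} (hΦ : ContinuousOn Φ (Set.Icc t1 1))
    (hB : ContinuousOn B (Set.Icc t1 1)) (hB' : ∀ t ∈ Set.Ioo t1 1, HasDerivAt B (B' t) t)
    (hD : ∀ t ∈ Set.Ioo t1 1, ∃ D, HasDerivWithinAt Φ D (Set.Ici t) t ∧ D ≤ B' t) :
    ∀ t ∈ Set.Icc t1 1, Φ t - Φ t1 ≤ B t - B t1 := by
  intro x hx
  rcases eq_or_lt_of_le hx.1 with rfl | hlt
  · simp
  choose! D hD1 hD2 using hD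
  have key : ∀ s ∈ Set.Ioo t1 x, Φ x ≤ Φ s + (B x - B s) := by
    intro s hs
    have hsub : Set.Icc s 1 ⊆ Set.Icc t1 1 := Set.Icc_subset_Icc_left hs.1.le
    have hsub2 : Set.Ico s 1 ⊆ Set.Ioo t1 1 := fun y hy => ⟨lt_of_lt_of_le hs.1 hy.1, hy.2⟩
    exact image_le_of_deriv_right_le_deriv_boundary (f' := D) (B := fun y => Φ s + (B y - B s))
      (B' := B') (hΦ.mono hsub) (fun y hy => hD1 y (hsub2 hy)) (by simp)
      (continuousOn_const.add ((hB.mono hsub).sub continuousOn_const))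
      (fun y hy => ((hB' y (hsub2 hy)).sub_const _).const_add _ |>.hasDerivWithinAt)
      (fun y hy => hD2 y (hsub2 hy)) ⟨hs.2.le, hx.2⟩
  have hle : 𝓝[Set.Ioo t1 x] t1 ≤ 𝓝[Set.Icc t1 1] t1 := nhdsWithin_mono _
    (fun y hy => ⟨hy.1.le, hy.2.le.trans hx.2⟩)
  have l1 : Tendsto Φ (𝓝[Set.Ioo t1 x] t1) (𝓝 (Φ t1)) :=
    (hΦ t1 ⟨le_rfl, hx.1.trans hx.2⟩).mono_left hle
  have l2 : Tendsto B (𝓝[Set.Ioo t1 x] t1) (𝓝 (B t1)) :=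
    (hB t1 ⟨le_rfl, hx.1.trans hx.2⟩).mono_left hle
  have l3 : Tendsto (fun s => Φ s + (B x - B s)) (𝓝[Set.Ioo t1 x] t1) (𝓝 (Φ t1 + (B x - B t1))) :=
    l1.add (tendsto_const_nhds.sub l2)
  have : (𝓝[Set.Ioo t1 x] t1).NeBot := by
    rw [nhdsWithin_Ioo_eq_nhdsGT hlt]; infer_instance
  have := ge_of_tendsto l3 (by filter_upwards [self_mem_nhdsWithin] with s hs using key s hs)
  linarith

lemma Phi_cont {Ω : Set E2} (hopen : IsOpen Ω) (hb : Bornology.IsBounded Ω) {d S : ℝ}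
    {a : E2 → E2} {f : ℝ → ℝ} {u : E2 → ℝ → ℝ} (h : OneSol Ω d a f u) (hS0 : 0 ≤ S)
    (hS : ∀ x ∈ closure Ω, ∀ t ∈ Set.Icc (0:ℝ) 1, u x t ≤ S) {ε : ℝ} (hε : 0 < ε)
    {G : E2 → ℝ → ℝ} {Γ : ℝ}
    (hGc : ∀ t ∈ Set.Icc (0:ℝ) 1, ContinuousOn (fun x => G x t) Ω)
    (hGb : ∀ x ∈ Ω, ∀ t ∈ Set.Icc (0:ℝ) 1, |G x t| ≤ Γ)
    (hGt : ∀ x ∈ Ω, ContinuousOn (G x) (Set.Icc 0 1)) :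
    ContinuousOn (fun t => ∫ x in Ω, (max (u x t - ε) 0) ^ 3 * G x t) (Set.Icc 0 1) := by
  have hfin : volume Ω < ⊤ := hb.measure_lt_top
  have : IsFiniteMeasure (volume.restrict Ω) := ⟨by simpa using hfin⟩
  refine continuousOn_of_dominated (bound := fun _ => S ^ 3 * Γ) ?_ ?_ (integrable_const _) ?_
  · intro t ht
    have h1 : ContinuousOn (fun x => u x t) Ω := (sol_slice h ht).mono subset_closure
    exact ((((h1.sub continuousOn_const).sup continuousOn_const).pow 3).mul (hGc t ht)).aestronglyMeasurable
      hopen.measurableSet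
  · intro t ht
    rw [ae_restrict_iff' hopen.measurableSet]
    refine ae_of_all _ fun x hx => ?_
    have hq0 : 0 ≤ max (u x t - ε) 0 := le_max_right _ _
    have hqS : max (u x t - ε) 0 ≤ S := max_le (by linarith [hS x (subset_closure hx) t ht]) hS0
    rw [Real.norm_eq_abs, abs_mul, abs_of_nonneg (pow_nonneg hq0 3)]
    exact mul_le_mul (pow_le_pow_left₀ hq0 hqS 3) (hGb x hx t ht) (abs_nonneg _) (by positivity)
  · rw [ae_restrict_iff' hopen.measurableSet]
    refine ae_of_all _ fun x hx => ?_
    have h1 : ContinuousOn (fun t => u x t) (Set.Icc 0 1) :=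
      h.cont.comp (by fun_prop : ContinuousOn (fun t : ℝ => (x, t)) (Set.Icc 0 1))
        (fun t ht => ⟨subset_closure hx, ht⟩)
    exact (((h1.sub continuousOn_const).sup continuousOn_const).pow 3).mul (hGt x hx)

lemma grad_ineq {Ω : Set E2} (hopen : IsOpen Ω) (hb : Bornology.IsBounded Ω) {ε : ℝ} (hε : 0 < ε)
    {w : E2 → ℝ} (hwc : ContinuousOn w (closure Ω)) (hbd : ∀ x ∈ frontier Ω, w x = 0)
    (hw : ∀ x ∈ Ω, ContDiffAt ℝ 2 w x) :
    ∫ x in Ω, (max (w x - ε) 0) ^ 3 ≤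
      (volume Ω).toReal * 9 / 32 * ∫ x in Ω, max (w x - ε) 0 * ∑ i, (pd w i x) ^ 2 := by
  obtain ⟨hK, hKΩ⟩ := superlevel_compact hopen hb hwc hbd hε
  set K := {x ∈ closure Ω | ε ≤ w x} with hKdef
  have hqz : ∀ x ∈ Ω, x ∉ K → max (w x - ε) 0 = 0 := by
    intro x hx hxK
    have : w x < ε := by
      by_contra! hcon
      exact hxK ⟨subset_closure hx, hcon⟩
    exact max_eq_right (by linarith)
  have hφ : ContDiff ℝ 1 (fun s : ℝ => (max s 0) ^ (3 / 2 : ℝ)) := by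
    rw [contDiff_one_iff_deriv]
    refine ⟨fun s => (hasDerivAt_max_rpow s).differentiableAt, ?_⟩
    have : deriv (fun s : ℝ => (max s 0) ^ (3 / 2 : ℝ)) = fun s : ℝ => (3 / 2) * (max s 0) ^ (1 / 2 : ℝ) := by
      funext s; exact (hasDerivAt_max_rpow s).deriv
    rw [this]
    exact continuous_const.mul ((continuous_id.max continuous_const).rpow_const
      (fun x => Or.inr (by norm_num)))
  set F : E2 → ℝ := fun y => (max (w y - ε) 0) ^ (3 / 2 : ℝ) with hF
  have hF1 : ∀ x ∈ Ω, ContDiffAt ℝ 1 F x := by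
    intro x hx
    exact hφ.contDiffAt.comp x (((hw x hx).of_le (by norm_num)).sub contDiffAt_const)
  have hF0 : ∀ x ∈ Ω, x ∉ K → F x = 0 := by
    intro x hx hxK
    simp only [hF, hqz x hx hxK]
    exact Real.zero_rpow (by norm_num)
  obtain ⟨c1, c2, c3, c4⟩ := ext_zero hopen hK hKΩ hF1 hF0
  have hP := poincare hopen hb c1 c2 c4 (fun x hx => Set.indicator_of_notMem hx F)
  have e1 : ∫ x in Ω, (max (w x - ε) 0) ^ 3 = ∫ x in Ω, Ω.indicator F x ^ 2 := by
    refine setIntegral_congr_fun hopen.measurableSet (fun x hx => ?_)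
    simp only [Set.indicator_of_mem hx, hF]
    rw [← Real.rpow_natCast, ← Real.rpow_natCast, ← Real.rpow_mul (le_max_right _ _)]
    norm_num
  have e2 : ∫ x in Ω, ∑ i, (pd (Ω.indicator F) i x) ^ 2 =
      9 / 4 * ∫ x in Ω, max (w x - ε) 0 * ∑ i, (pd w i x) ^ 2 := by
    rw [← integral_const_mul]
    refine setIntegral_congr_fun hopen.measurableSet (fun x hx => ?_)
    have e3 : ∀ i, pd F i x = (3 / 2) * (max (w x - ε) 0) ^ (1 / 2 : ℝ) * pd w i x := by
      intro i
      exact pd_comp (φ := fun s => (max (s - ε) 0) ^ (3 / 2 : ℝ)) ((hw x hx).differentiableAt (by norm_num))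
        ((hasDerivAt_max_rpow (w x - ε)).comp_sub_const (w x) ε) i
    have e4 : ((max (w x - ε) 0) ^ (1 / 2 : ℝ)) ^ 2 = max (w x - ε) 0 := by
      rw [← Real.rpow_natCast, ← Real.rpow_mul (le_max_right _ _)]
      norm_num
    have e5 : ∀ i, pd (Ω.indicator F) i x ^ 2 = 9 / 4 * (max (w x - ε) 0 * pd w i x ^ 2) := by
      intro i
      rw [c3 i x hx, e3, mul_pow, mul_pow, e4]; ring
    simp only [e5, Fin.sum_univ_two]; ring
  rw [e1]
  rw [e2] at hP
  refine hP.trans (le_of_eq ?_)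
  ring

lemma energy_decay {Ω : Set E2} (hopen : IsOpen Ω) (hb : Bornology.IsBounded Ω) {d A S r : ℝ} (hd : 0 < d)
    {a : E2 → E2} (ha : ∀ x ∈ Ω, ∀ i, |a x i| ≤ A) (haC : ContDiffOn ℝ 1 a (closure Ω))
    (hdiv : ∀ x ∈ Ω, (∑ i, pd (fun y => a y i) i x) = 0)
    {f : ℝ → ℝ} (hf : Continuous f) (hfr : ∀ s, 0 ≤ s → f s ≤ r * s)
    {u : E2 → ℝ → ℝ} (h : OneSol Ω d a f u) (hS0 : 0 ≤ S)
    (hS : ∀ x ∈ closure Ω, ∀ t ∈ Set.Icc (0:ℝ) 1, u x t ≤ S) (hV : 0 < (volume Ω).toReal)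
    {t : ℝ} (ht : t ∈ Set.Icc (0:ℝ) 1) :
    ∫ x in Ω, u x t ^ 3 ≤ Real.exp ((3 * r - 64 * d / (3 * (volume Ω).toReal)) * t) * ∫ x in Ω, u x 0 ^ 3 := by
  have hfin : volume Ω < ⊤ := hb.measure_lt_top
  have : IsFiniteMeasure (volume.restrict Ω) := ⟨by simpa using hfin⟩
  set V := (volume Ω).toReal with hVdef
  set k := 3 * r - 64 * d / (3 * V) with hk
  have h00 : (0:ℝ) ∈ Set.Icc (0:ℝ) 1 := ⟨le_rfl, zero_le_one⟩
  have icu : ∀ s ∈ Set.Icc (0:ℝ) 1, IntegrableOn (fun x => u x s ^ 3) Ω := by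
    intro s hs
    have hK : IsCompact (closure Ω) := Metric.isCompact_of_isClosed_isBounded isClosed_closure hb.closure
    exact (((sol_slice h hs).pow 3).integrableOn_compact hK).mono_set subset_closure
  have icq : ∀ ε : ℝ, ∀ n : ℕ, ∀ s ∈ Set.Icc (0:ℝ) 1, IntegrableOn (fun x => (max (u x s - ε) 0) ^ n) Ω := by
    intro ε n s hs
    have hK : IsCompact (closure Ω) := Metric.isCompact_of_isClosed_isBounded isClosed_closure hb.closure
    exact (((((sol_slice h hs).sub continuousOn_const).sup continuousOn_const).pow n).integrableOn_compact hK).mono_set subset_closure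
  set C := Real.exp |k| * (3 * |r| * S ^ 2 * V) with hC
  have hC0 : 0 ≤ C := by positivity
  have key : ∀ ε > 0, (∫ x in Ω, (max (u x t - ε) 0) ^ 3) * Real.exp (-(k * t)) - (∫ x in Ω, (max (u x 0 - ε) 0) ^ 3)
      ≤ C * ε := by
    intro ε hε
    set G : E2 → ℝ → ℝ := fun _ s => Real.exp (-(k * s)) with hG
    have hGd : ∀ s, HasDerivAt (fun s => Real.exp (-(k * s))) (-k * Real.exp (-(k * s))) s := by
      intro s
      have h1 : HasDerivAt (fun s : ℝ => -(k * s)) (-(k * 1)) s := ((hasDerivAt_id s).const_mul k).neg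
      convert h1.exp using 1
      ring
    have hGabs : ∀ s ∈ Set.Icc (0:ℝ) 1, |Real.exp (-(k * s))| ≤ Real.exp |k| := by
      intro s hs
      rw [abs_of_pos (Real.exp_pos _)]
      apply Real.exp_le_exp.2
      have := neg_abs_le (k * s)
      rw [abs_mul, abs_of_nonneg hs.1] at this
      nlinarith [hs.2, abs_nonneg k]
    have hLip : ∀ s ∈ Set.Icc (0:ℝ) 1, ∀ t0 ∈ Set.Icc (0:ℝ) 1,
        |Real.exp (-(k * s)) - Real.exp (-(k * t0))| ≤ (|k| * Real.exp |k|) * |s - t0| := by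
      intro s hs t0 ht0
      have := Convex.norm_image_sub_le_of_norm_hasDerivWithin_le (f := fun s => Real.exp (-(k * s)))
        (f' := fun s => -k * Real.exp (-(k * s))) (C := |k| * Real.exp |k|) (s := Set.Icc (0:ℝ) 1)
        (fun y _ => (hGd y).hasDerivWithinAt) (fun y hy => by
          rw [norm_mul, norm_neg, Real.norm_eq_abs, Real.norm_eq_abs]
          exact mul_le_mul_of_nonneg_left (hGabs y hy) (abs_nonneg _)) (convex_Icc 0 1) ht0 hs
      exact this
    have hcΦ := Phi_cont hopen hb h hS0 hS hε (G := G) (fun s _ => continuousOn_const)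
      (fun x _ s hs => hGabs s hs) (fun x _ => by simp only [hG]; fun_prop)
    have := ode_le (t1 := 0) hcΦ (B := fun s => C * ε * s) (B' := fun _ => C * ε) (by fun_prop)
      (fun s _ => by simpa using (hasDerivAt_id s).const_mul (C * ε)) (fun t0 ht0 => by
        have ht0' : t0 ∈ Set.Icc (0:ℝ) 1 := ⟨ht0.1.le, ht0.2.le⟩
        obtain ⟨D, hD1, hD2, hD3⟩ := energy_deriv hopen hb hd ha haC hdiv hf hfr h hS0 hS ht0 hε (G := G)
          (Gt := fun _ => -k * Real.exp (-(k * t0))) (CG := |k| * Real.exp |k|) (by positivity)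
          (fun s _ => contDiff_const) (fun x => (Real.exp_pos _).le) continuous_const
          (fun x _ s hs => hGabs s hs) (fun x _ s hs => hLip s hs t0 ht0') (fun x _ => hGd t0)
        refine ⟨D, hD1, hD3.trans ?_⟩
        have hgr := grad_ineq hopen hb hε (sol_slice h ht0') (fun x hx => h.bdry x hx t0 ht0')
          (h.C2 t0 ⟨ht0.1, ht0.2.le⟩)
        set E := Real.exp (-(k * t0)) with hE
        have hE0 : 0 < E := Real.exp_pos _
        have hEle : E ≤ Real.exp |k| := (le_abs_self _).trans (hGabs t0 ht0')
        have e1 : ∫ x in Ω, 6 * d * max (u x t0 - ε) 0 * (∑ i, (pd (fun y => u y t0) i x) ^ 2) * G x t0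
            = 6 * d * E * ∫ x in Ω, max (u x t0 - ε) 0 * (∑ i, (pd (fun y => u y t0) i x) ^ 2) := by
          rw [← integral_const_mul]
          refine integral_congr_ae (ae_of_all _ fun x => ?_)
          simp only [hG, hE]; ring
        have epd : ∀ i : Fin 2, pd (fun _ : E2 => Real.exp (-(k * t0))) i = fun _ => 0 := by
          intro i; funext x; simp [pd]
        have elap : ∀ x, lap (fun _ : E2 => Real.exp (-(k * t0))) x = 0 := by
          intro x; simp only [lap, pd2, epd]; simp [pd]
        have e2 : ∫ x in Ω, ((max (u x t0 - ε) 0) ^ 3 * (d * lap (fun y => G y t0) x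
            + (∑ i, a x i * pd (fun y => G y t0) i x) + -k * Real.exp (-(k * t0)) + 3 * r * G x t0)
            + 3 * |r| * ε * (max (u x t0 - ε) 0) ^ 2 * G x t0)
            = (E * (3 * r - k)) * (∫ x in Ω, (max (u x t0 - ε) 0) ^ 3)
              + (3 * |r| * ε * E) * ∫ x in Ω, (max (u x t0 - ε) 0) ^ 2 := by
          rw [← integral_const_mul, ← integral_const_mul,
            ← integral_add ((icq ε 3 t0 ht0').const_mul _) ((icq ε 2 t0 ht0').const_mul _)]
          refine integral_congr_ae (ae_of_all _ fun x => ?_)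
          simp only [hG, elap, epd, hE]
          simp only [mul_zero, Finset.sum_const_zero]
          ring
        rw [e1, e2]
        have e3 : ∫ x in Ω, (max (u x t0 - ε) 0) ^ 2 ≤ S ^ 2 * V := by
          have : ∫ x in Ω, (max (u x t0 - ε) 0) ^ 2 ≤ ∫ x in Ω, S ^ 2 := by
            refine setIntegral_mono_on (icq ε 2 t0 ht0') (integrable_const _) hopen.measurableSet (fun x hx => ?_)
            exact pow_le_pow_left₀ (le_max_right _ _)
              (max_le (by linarith [hS x (subset_closure hx) t0 ht0']) hS0) 2
          rw [setIntegral_const] at this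
          simp only [smul_eq_mul, Measure.real] at this
          rw [mul_comm]; exact this
        set P := ∫ x in Ω, (max (u x t0 - ε) 0) ^ 3
        set Q := ∫ x in Ω, max (u x t0 - ε) 0 * (∑ i, (pd (fun y => u y t0) i x) ^ 2)
        have e4 : 3 * r - k = 64 * d / (3 * V) := by rw [hk]; ring
        have e5 : 64 * d / (3 * V) * P ≤ 6 * d * Q := by
          have := mul_le_mul_of_nonneg_left hgr (by positivity : 0 ≤ 64 * d / (3 * V))
          refine this.trans (le_of_eq ?_)
          field_simp
          ring
        rw [e4]
        have e6 := mul_le_mul_of_nonneg_left e5 hE0.le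
        have e7 : 3 * |r| * ε * E * ∫ x in Ω, (max (u x t0 - ε) 0) ^ 2 ≤ 3 * |r| * ε * Real.exp |k| * (S ^ 2 * V) := by
          gcongr
        rw [hC]
        nlinarith [e6, e7]) t ht
    simp only [hG] at this
    rw [integral_mul_const, integral_mul_const] at this
    simp only [mul_zero, neg_zero, Real.exp_zero, mul_one, sub_zero] at this
    refine this.trans ?_
    have := mul_le_mul_of_nonneg_left ht.2 (mul_nonneg hC0 hε.le)
    linarith
  have key2 : ∀ ε > 0, (∫ x in Ω, u x t ^ 3) * Real.exp (-(k * t)) ≤ (∫ x in Ω, u x 0 ^ 3)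
      + ε * (C + 3 * S ^ 2 * V * Real.exp (-(k * t))) := by
    intro ε hε
    have h1 := key ε hε
    have h2 : ∫ x in Ω, (max (u x 0 - ε) 0) ^ 3 ≤ ∫ x in Ω, u x 0 ^ 3 := by
      refine setIntegral_mono_on (icq ε 3 0 h00) (icu 0 h00) hopen.measurableSet (fun x hx => ?_)
      have := h.nonneg x (subset_closure hx) 0 h00
      exact pow_le_pow_left₀ (le_max_right _ _) (max_le (by linarith) this) 3
    have h3 : ∫ x in Ω, u x t ^ 3 ≤ (∫ x in Ω, (max (u x t - ε) 0) ^ 3) + 3 * S ^ 2 * ε * V := by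
      have ic : IntegrableOn (fun _ : E2 => 3 * S ^ 2 * ε) Ω := integrable_const _
      have : ∫ x in Ω, u x t ^ 3 ≤ ∫ x in Ω, ((max (u x t - ε) 0) ^ 3 + 3 * S ^ 2 * ε) := by
        refine setIntegral_mono_on (icu t ht) ((icq ε 3 t ht).add ic) hopen.measurableSet (fun x hx => ?_)
        have hu := h.nonneg x (subset_closure hx) t ht
        have huS := hS x (subset_closure hx) t ht
        have := cube_lip hu (le_max_right (u x t - ε) 0) huS (max_le (by linarith) hS0)
        have h4 := (abs_le.1 this).2
        have h5 : |u x t - max (u x t - ε) 0| ≤ ε := by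
          rw [abs_le]
          constructor
          · rcases max_cases (u x t - ε) 0 with ⟨h6, _⟩ | ⟨h6, _⟩ <;> rw [h6] <;> linarith
          · linarith [le_max_left (u x t - ε) 0]
        nlinarith [mul_le_mul_of_nonneg_left h5 (by positivity : 0 ≤ 3 * S ^ 2)]
      rw [integral_add (icq ε 3 t ht) ic, setIntegral_const] at this
      simp only [smul_eq_mul, Measure.real] at this
      linarith
    have h6 := mul_le_mul_of_nonneg_right h3 (Real.exp_pos (-(k * t))).le
    nlinarith
  have key3 : (∫ x in Ω, u x t ^ 3) * Real.exp (-(k * t)) ≤ (∫ x in Ω, u x 0 ^ 3) := by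
    set C2 := C + 3 * S ^ 2 * V * Real.exp (-(k * t))
    have hC2 : 0 ≤ C2 := by positivity
    refine le_of_forall_pos_le_add fun δ hδ => ?_
    refine (key2 (δ / (C2 + 1)) (by positivity)).trans ?_
    have : δ / (C2 + 1) * C2 ≤ δ := by
      rw [div_mul_eq_mul_div, div_le_iff₀ (by positivity)]; nlinarith
    linarith
  have := mul_le_mul_of_nonneg_left key3 (Real.exp_pos (k * t)).le
  refine le_trans (le_of_eq ?_) this
  rw [mul_comm (∫ x in Ω, u x t ^ 3), ← mul_assoc, ← Real.exp_add]
  simp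

lemma sup_bound {Ω : Set E2} (hopen : IsOpen Ω) (hb : Bornology.IsBounded Ω) {d r : ℝ} (hd : 0 < d)
    {a : E2 → E2} {f : ℝ → ℝ} (hfr : ∀ s, 0 ≤ s → f s ≤ r * s)
    {u : E2 → ℝ → ℝ} (h : OneSol Ω d a f u) {Y : ℝ} (hY : 0 ≤ Y)
    (h0 : ∀ x ∈ Ω, u x 0 ≤ Y) :
    ∀ x ∈ closure Ω, ∀ t ∈ Set.Icc (0:ℝ) 1, u x t ≤ Real.exp (|r| + 1) * Y := by
  set k := |r| + 1 with hk
  have hk0 : 0 < k := by positivity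
  have h00 : (0:ℝ) ∈ Set.Icc (0:ℝ) 1 := ⟨le_rfl, zero_le_one⟩
  have key := weak_max hopen hb (t0 := 0) (fun x t => u x t * Real.exp (-(k * t)) - Y)
    ((h.cont.mul (by fun_prop)).sub continuousOn_const)
    (fun x hx => by
      simp only [mul_zero, neg_zero, Real.exp_zero, mul_one]
      by_cases hxΩ : x ∈ Ω
      · linarith [h0 x hxΩ]
      · have : x ∈ frontier Ω := by rw [hopen.frontier_eq]; exact ⟨hx, hxΩ⟩
        rw [h.bdry x this 0 h00]; linarith)
    (fun x hx t ht => by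
      rw [h.bdry x hx t ht]; linarith)
    (fun x hx t ht hpos hmax => by
      have hE := Real.exp_pos (-(k * t))
      have hu : 0 < u x t := by
        by_contra! hcon
        nlinarith
      have hmax' : IsLocalMax (fun y => u y t) x := by
        filter_upwards [hmax] with y hy
        have : u y t * Real.exp (-(k * t)) ≤ u x t * Real.exp (-(k * t)) := by linarith
        exact le_of_mul_le_mul_right this hE
      have hmm := fun i => pd_pd2_of_localMax (h.C2 t ht x hx) hmax' i
      have h1 : HasDerivAt (fun s : ℝ => -(k * s)) (-(k * 1)) t := ((hasDerivAt_id t).const_mul k).neg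
      refine ⟨_, ((h.C1 x hx t ht).hasDerivAt.mul h1.exp).sub_const Y, ?_⟩
      rw [h.pde x hx t ht]
      have h2 : (∑ i, a x i * pd (fun y => u y t) i x) = 0 :=
        Finset.sum_eq_zero fun i _ => by rw [(hmm i).1, mul_zero]
      have h3 : lap (fun y => u y t) x ≤ 0 := Finset.sum_nonpos fun i _ => (hmm i).2
      have h4 := hfr (u x t) hu.le
      rw [h2]
      have h5 : d * lap (fun y => u y t) x - 0 + f (u x t) - k * u x t < 0 := by
        have : d * lap (fun y => u y t) x ≤ 0 := mul_nonpos_of_nonneg_of_nonpos hd.le h3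
        nlinarith [le_abs_self r]
      nlinarith [mul_pos hE (neg_pos.2 h5)])
  intro x hx t ht
  have h1 : u x t * Real.exp (-(k * t)) - Y ≤ 0 := key x hx t ht
  have h2 : u x t ≤ Real.exp (k * t) * Y := by
    have := mul_le_mul_of_nonneg_left (sub_nonpos.1 h1) (Real.exp_pos (k * t)).le
    refine le_trans (le_of_eq ?_) this
    rw [mul_comm (u x t), ← mul_assoc, ← Real.exp_add]; simp
  refine h2.trans (mul_le_mul_of_nonneg_right (Real.exp_le_exp.2 ?_) hY)
  nlinarith [ht.2]

lemma gauss_contDiff (x0 : E2) (b c : ℝ) :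
    ContDiff ℝ 2 (fun y : E2 => c * Real.exp (-(b * ‖y - x0‖ ^ 2))) := by
  have h1 : ContDiff ℝ 2 (fun y : E2 => ‖y - x0‖ ^ 2) :=
    (contDiff_id.sub contDiff_const).norm_sq ℝ
  exact contDiff_const.mul ((contDiff_const.mul h1).neg.exp)

lemma gauss_pd (x0 : E2) (b c : ℝ) (i : Fin 2) (y : E2) :
    pd (fun y : E2 => c * Real.exp (-(b * ‖y - x0‖ ^ 2))) i y =
      -(2 * b) * ((y i - x0 i) * (c * Real.exp (-(b * ‖y - x0‖ ^ 2)))) := by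
  have h1 := pd_quad x0 0 0 (-b) i y
  have h2 := hasFDerivAt_quad x0 0 0 (-b) y
  simp only [_root_.zero_apply, zero_add, neg_mul] at h1 h2
  have h3 := pd_comp (w := fun y : E2 => -(b * ‖y - x0‖ ^ 2)) (φ := fun s => c * Real.exp s)
    h2.differentiableAt ((Real.hasDerivAt_exp _).const_mul c) i
  rw [h3, h1]; ring

lemma gauss_lap (x0 : E2) (b c : ℝ) (y : E2) :
    lap (fun y : E2 => c * Real.exp (-(b * ‖y - x0‖ ^ 2))) y =
      (4 * b ^ 2 * ‖y - x0‖ ^ 2 - 4 * b) * (c * Real.exp (-(b * ‖y - x0‖ ^ 2))) := by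
  have h2 : ∀ i, pd2 (fun y : E2 => c * Real.exp (-(b * ‖y - x0‖ ^ 2))) i i y =
      (4 * b ^ 2 * (y i - x0 i) ^ 2 - 2 * b) * (c * Real.exp (-(b * ‖y - x0‖ ^ 2))) := by
    intro i
    rw [pd2]
    simp_rw [gauss_pd]
    have d1 : DifferentiableAt ℝ (fun y : E2 => y i - x0 i) y :=
      ((hasFDerivAt_coord i y).sub_const (x0 i)).differentiableAt
    have d2 : DifferentiableAt ℝ (fun y : E2 => c * Real.exp (-(b * ‖y - x0‖ ^ 2))) y :=
      (gauss_contDiff x0 b c).contDiffAt.differentiableAt (by norm_num)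
    have d3 : DifferentiableAt ℝ (fun y : E2 => (y i - x0 i) * (c * Real.exp (-(b * ‖y - x0‖ ^ 2)))) y :=
      d1.mul d2
    have e1 : pd (fun y : E2 => y i - x0 i) i y = 1 := by
      rw [pd, ((hasFDerivAt_coord i y).sub_const (x0 i)).fderiv]; simp
    rw [pd_const_mul d3, pd_mul d1 d2, gauss_pd, e1]; ring
  have h3 : ‖y - x0‖ ^ 2 = (y 0 - x0 0) ^ 2 + (y 1 - x0 1) ^ 2 := by
    rw [EuclideanSpace.norm_sq_eq]; simp [Fin.sum_univ_two]
  rw [lap, Fin.sum_univ_two, h2, h2, h3]; ring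

lemma gauss_int (x0 : E2) {b : ℝ} (hb : 0 < b) :
    Integrable (fun y : E2 => Real.exp (-(b * ‖y - x0‖ ^ 2))) ∧
    ∫ y : E2, Real.exp (-(b * ‖y - x0‖ ^ 2)) = Real.pi / b := by
  have h1 : ∫ y : E2, Real.exp (-(b * ‖y - x0‖ ^ 2)) = Real.pi / b := by
    rw [integral_sub_right_eq_self (fun y : E2 => Real.exp (-(b * ‖y‖ ^ 2))) x0]
    have := GaussianFourier.integral_rexp_neg_mul_sq_norm (V := E2) hb
    simp only [neg_mul] at this
    rw [this]; simp
  refine ⟨?_, h1⟩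
  by_contra hcon
  rw [integral_undef hcon] at h1
  have : 0 < Real.pi / b := by positivity
  linarith

lemma y_exp_le {y : ℝ} : y ≤ Real.exp (y ^ 2) := by
  have := Real.add_one_le_exp (y ^ 2)
  nlinarith [sq_nonneg (y - 1)]

def hk (d r τ : ℝ) (x0 : E2) (x : E2) (t : ℝ) : ℝ :=
  (Real.exp (-(3 * r * t)) * (1 + τ - t)⁻¹) * Real.exp (-((4 * d * (1 + τ - t))⁻¹ * ‖x - x0‖ ^ 2))

def hkt (d r τ : ℝ) (x0 : E2) (x : E2) (t : ℝ) : ℝ :=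
  hk d r τ x0 x t * (-(3 * r) + (1 + τ - t)⁻¹ - ‖x - x0‖ ^ 2 / (4 * d) * ((1 + τ - t) ^ 2)⁻¹)

lemma hk_deriv {d r τ t : ℝ} (hd : 0 < d) (x0 x : E2) (ht : 0 < 1 + τ - t) :
    HasDerivAt (hk d r τ x0 x) (hkt d r τ x0 x t) t := by
  have hs : HasDerivAt (fun t : ℝ => 1 + τ - t) (-1) t := by
    simpa using (hasDerivAt_id t).const_sub (1 + τ)
  have h1 : HasDerivAt (fun t : ℝ => -(3 * r * t)) (-(3 * r * 1)) t :=
    ((hasDerivAt_id t).const_mul (3 * r)).neg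
  have h2 := hs.inv ht.ne'
  have h3 : HasDerivAt (fun t : ℝ => 4 * d * (1 + τ - t)) (4 * d * (-1)) t := hs.const_mul (4 * d)
  have h4 : HasDerivAt (fun t : ℝ => -((4 * d * (1 + τ - t))⁻¹ * ‖x - x0‖ ^ 2))
    (-(-(4 * d * (-1)) / (4 * d * (1 + τ - t)) ^ 2 * ‖x - x0‖ ^ 2)) t :=
    ((h3.inv (by positivity)).mul_const _).neg
  have h5 := (h1.exp.mul h2).mul h4.exp
  refine h5.congr_deriv ?_
  simp only [hkt, hk, Pi.mul_apply, Pi.inv_apply]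
  generalize Real.exp (-(3 * r * t)) = E1
  generalize Real.exp (-((4 * d * (1 + τ - t))⁻¹ * ‖x - x0‖ ^ 2)) = E2
  have hne := ht.ne'
  have hdne := hd.ne'
  field_simp
  ring

lemma hk_heat {d r τ t : ℝ} (hd : 0 < d) (x0 x : E2) (ht : 0 < 1 + τ - t) :
    d * lap (fun y => hk d r τ x0 y t) x + hkt d r τ x0 x t + 3 * r * hk d r τ x0 x t = 0 := by
  have := gauss_lap x0 ((4 * d * (1 + τ - t))⁻¹) (Real.exp (-(3 * r * t)) * (1 + τ - t)⁻¹) x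
  simp only [hkt]
  rw [show (fun y => hk d r τ x0 y t) = fun y => (Real.exp (-(3 * r * t)) * (1 + τ - t)⁻¹) *
    Real.exp (-((4 * d * (1 + τ - t))⁻¹ * ‖y - x0‖ ^ 2)) from rfl, this]
  change d * (_ * hk d r τ x0 x t) + _ + _ = 0
  have hne := ht.ne'
  have hdne := hd.ne'
  field_simp
  ring

lemma exp3_le {r t : ℝ} (ht : t ∈ Set.Icc (0:ℝ) 1) : Real.exp (-(3 * r * t)) ≤ Real.exp (3 * |r|) := by
  apply Real.exp_le_exp.2
  nlinarith [neg_abs_le r, abs_nonneg r, ht.1, ht.2, mul_nonneg ht.1 (abs_nonneg r)]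

lemma hk_le {d r τ t : ℝ} (hd : 0 < d) (x0 x : E2) (h0 : t ∈ Set.Icc (0:ℝ) 1) (ht : 0 < 1 + τ - t) :
    hk d r τ x0 x t ≤ Real.exp (3 * |r|) * (1 + τ - t)⁻¹ * Real.exp (-((8 * d * (1 + τ - t))⁻¹ * ‖x - x0‖ ^ 2)) := by
  unfold hk
  have h1 : (8 * d * (1 + τ - t))⁻¹ ≤ (4 * d * (1 + τ - t))⁻¹ := by
    apply inv_anti₀ (by positivity)
    nlinarith [mul_pos hd ht]
  have := exp3_le (r := r) h0
  gcongr

lemma hk_grad {d r τ t A : ℝ} (hd : 0 < d) (x0 x : E2) (h0 : t ∈ Set.Icc (0:ℝ) 1) (ht : 0 < 1 + τ - t)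
    (a : E2) (ha : ∀ i, |a i| ≤ A) :
    ∑ i, a i * pd (fun y => hk d r τ x0 y t) i x ≤
      A * Real.sqrt (8 * d) / d * (Real.sqrt (1 + τ - t))⁻¹ * (Real.exp (3 * |r|) * (1 + τ - t)⁻¹ *
        Real.exp (-((8 * d * (1 + τ - t))⁻¹ * ‖x - x0‖ ^ 2))) := by
  have hA : 0 ≤ A := (abs_nonneg _).trans (ha 0)
  set s := 1 + τ - t with hs
  have hp : ∀ i, pd (fun y => hk d r τ x0 y t) i x = -(2 * (4 * d * s)⁻¹) * ((x i - x0 i) * hk d r τ x0 x t) :=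
    fun i => gauss_pd x0 _ _ i x
  have hk0 : 0 ≤ hk d r τ x0 x t := by unfold hk; positivity
  have hc : ∀ i, a i * pd (fun y => hk d r τ x0 y t) i x ≤ A * ((2 * d * s)⁻¹ * (‖x - x0‖ * hk d r τ x0 x t)) := by
    intro i
    rw [hp]
    refine (le_abs_self _).trans ?_
    rw [abs_mul, abs_mul, abs_mul, abs_neg, abs_of_nonneg hk0, abs_of_pos (by positivity : 0 < 2 * (4 * d * s)⁻¹)]
    have e1 : 2 * (4 * d * s)⁻¹ = (2 * d * s)⁻¹ := by field_simp; norm_num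
    have e2 : |x i - x0 i| ≤ ‖x - x0‖ := by
      have := PiLp.norm_apply_le (x - x0) i
      simpa using this
    rw [e1]
    have := ha i
    gcongr
  have e1 : ‖x - x0‖ * hk d r τ x0 x t ≤ Real.sqrt (8 * d * s) * (Real.exp (3 * |r|) * s⁻¹ *
        Real.exp (-((8 * d * s)⁻¹ * ‖x - x0‖ ^ 2))) := by
    have h8 : 0 < 8 * d * s := by positivity
    have hq := Real.sqrt_pos.2 h8
    have h1 : ‖x - x0‖ ≤ Real.sqrt (8 * d * s) * Real.exp ((8 * d * s)⁻¹ * ‖x - x0‖ ^ 2) := by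
      have := y_exp_le (y := ‖x - x0‖ / Real.sqrt (8 * d * s))
      rw [div_le_iff₀ hq, div_pow, Real.sq_sqrt h8.le] at this
      rw [inv_mul_eq_div]
      linarith
    have h2 := exp3_le (r := r) h0
    have h3 : Real.exp (-((4 * d * s)⁻¹ * ‖x - x0‖ ^ 2)) = Real.exp (-((8 * d * s)⁻¹ * ‖x - x0‖ ^ 2))
      * Real.exp (-((8 * d * s)⁻¹ * ‖x - x0‖ ^ 2)) := by
      rw [← Real.exp_add]; congr 1; field_simp; ring
    unfold hk
    rw [h3]
    calc _ ≤ Real.sqrt (8 * d * s) * Real.exp ((8 * d * s)⁻¹ * ‖x - x0‖ ^ 2) * (Real.exp (3 * |r|) * s⁻¹ *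
          (Real.exp (-((8 * d * s)⁻¹ * ‖x - x0‖ ^ 2)) * Real.exp (-((8 * d * s)⁻¹ * ‖x - x0‖ ^ 2)))) := by gcongr
      _ = _ := by
        have : Real.exp ((8 * d * s)⁻¹ * ‖x - x0‖ ^ 2) * Real.exp (-((8 * d * s)⁻¹ * ‖x - x0‖ ^ 2)) = 1 := by
          rw [← Real.exp_add]; simp
        linear_combination (Real.sqrt (8 * d * s) * Real.exp (3 * |r|) * s⁻¹ * Real.exp (-((8 * d * s)⁻¹ * ‖x - x0‖ ^ 2))) * this
  rw [Fin.sum_univ_two]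
  have e2 := mul_le_mul_of_nonneg_left e1 (by positivity : 0 ≤ A * (d * s)⁻¹)
  have e3 := add_le_add (hc 0) (hc 1)
  set Z := Real.exp (3 * |r|) * s⁻¹ * Real.exp (-((8 * d * s)⁻¹ * ‖x - x0‖ ^ 2))
  have e4 : A * (d * s)⁻¹ * (Real.sqrt (8 * d * s) * Z) = A * Real.sqrt (8 * d) / d * (Real.sqrt s)⁻¹ * Z := by
    rw [Real.sqrt_mul (by positivity : 0 ≤ 8 * d)]
    have hss : Real.sqrt s * Real.sqrt s = s := Real.mul_self_sqrt ht.le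
    have hsq := Real.sqrt_pos.2 ht
    have : s⁻¹ * Real.sqrt s = (Real.sqrt s)⁻¹ := by
      field_simp; nlinarith
    rw [mul_inv, ← this]; ring
  rw [← e4]
  refine e3.trans (le_trans (le_of_eq ?_) e2)
  field_simp; ring

lemma smooth_pre {Ω : Set E2} (hopen : IsOpen Ω) (hb : Bornology.IsBounded Ω) {d A S r : ℝ} (hd : 0 < d)
    (hA : 0 ≤ A)
    {a : E2 → E2} (ha : ∀ x ∈ Ω, ∀ i, |a x i| ≤ A) (haC : ContDiffOn ℝ 1 a (closure Ω))
    (hdiv : ∀ x ∈ Ω, (∑ i, pd (fun y => a y i) i x) = 0)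
    {f : ℝ → ℝ} (hf : Continuous f) (hfr : ∀ s, 0 ≤ s → f s ≤ r * s)
    {u : E2 → ℝ → ℝ} (h : OneSol Ω d a f u) (hS0 : 0 ≤ S)
    (hS : ∀ x ∈ closure Ω, ∀ t ∈ Set.Icc (0:ℝ) 1, u x t ≤ S)
    {η τ ε : ℝ} (hη : η ∈ Set.Ioo (0:ℝ) 1) (hτ : 0 < τ) (hε : 0 < ε) (x0 : E2) :
    ∫ x in Ω, (max (u x 1 - ε) 0) ^ 3 * hk d r τ x0 x 1 ≤
      Real.exp (3 * |r|) / η * (∫ x in Ω, u x (1 - η) ^ 3)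
      + 2 * (8 * Real.pi * Real.exp (3 * |r|) * (A * Real.sqrt (8 * d))) * S ^ 3 * Real.sqrt η
      + 24 * Real.pi * d * Real.exp (3 * |r|) * |r| * ε * S ^ 2 := by
  have hfin : volume Ω < ⊤ := hb.measure_lt_top
  have : IsFiniteMeasure (volume.restrict Ω) := ⟨by simpa using hfin⟩
  have hKc : IsCompact (closure Ω) := Metric.isCompact_of_isClosed_isBounded isClosed_closure hb.closure
  set c1 := 8 * Real.pi * Real.exp (3 * |r|) * (A * Real.sqrt (8 * d)) with hc1
  set c2 := 24 * Real.pi * d * Real.exp (3 * |r|) * |r| with hc2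
  have hc10 : 0 ≤ c1 := by positivity
  have hc20 : 0 ≤ c2 := by positivity
  have hspos : ∀ t ∈ Set.Icc (0:ℝ) 1, 0 < 1 + τ - t := fun t ht => by linarith [ht.2]
  have hsτ : ∀ t ∈ Set.Icc (0:ℝ) 1, τ ≤ 1 + τ - t := fun t ht => by linarith [ht.2]
  have hk0 : ∀ x, ∀ t ∈ Set.Icc (0:ℝ) 1, 0 ≤ hk d r τ x0 x t := by
    intro x t ht
    have := hspos t ht
    unfold hk; positivity
  have hkle : ∀ x, ∀ t ∈ Set.Icc (0:ℝ) 1, hk d r τ x0 x t ≤ Real.exp (3 * |r|) * (1 + τ - t)⁻¹ := by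
    intro x t ht
    have h1 := hspos t ht
    refine (hk_le hd x0 x ht h1).trans ?_
    refine mul_le_of_le_one_right (by positivity) ?_
    apply Real.exp_le_one_iff.2
    have : 0 ≤ (8 * d * (1 + τ - t))⁻¹ * ‖x - x0‖ ^ 2 := by positivity
    linarith
  have hkb : ∀ x, ∀ t ∈ Set.Icc (0:ℝ) 1, |hk d r τ x0 x t| ≤ Real.exp (3 * |r|) * τ⁻¹ := by
    intro x t ht
    rw [abs_of_nonneg (hk0 x t ht)]
    refine (hkle x t ht).trans ?_
    have := hsτ t ht
    gcongr
  have hk2 : ∀ t, ContDiff ℝ 2 (fun x => hk d r τ x0 x t) := fun t => gauss_contDiff x0 _ _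
  have hkd : ∀ x, ∀ t ∈ Set.Icc (0:ℝ) 1, HasDerivAt (hk d r τ x0 x) (hkt d r τ x0 x t) t := fun x t ht =>
    hk_deriv hd x0 x (hspos t ht)
  obtain ⟨R, hR⟩ := hb.exists_norm_le
  set CG := Real.exp (3 * |r|) * τ⁻¹ * (3 * |r| + τ⁻¹ + (R + ‖x0‖) ^ 2 / (4 * d) * (τ ^ 2)⁻¹) with hCG
  have hCG0 : 0 ≤ CG := by positivity
  have hktb : ∀ x ∈ Ω, ∀ t ∈ Set.Icc (0:ℝ) 1, |hkt d r τ x0 x t| ≤ CG := by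
    intro x hx t ht
    have h1 := hspos t ht
    have h2 := hsτ t ht
    unfold hkt
    rw [abs_mul]
    refine mul_le_mul (hkb x t ht) ?_ (abs_nonneg _) (by positivity)
    refine (abs_sub _ _).trans (add_le_add ((abs_add_le _ _).trans (add_le_add ?_ ?_)) ?_)
    · rw [abs_neg, abs_mul]; norm_num
    · rw [abs_of_pos (inv_pos.2 h1)]
      exact inv_anti₀ hτ h2
    · rw [abs_of_nonneg (by positivity)]
      have h3 : ‖x - x0‖ ≤ R + ‖x0‖ := (norm_sub_le _ _).trans (by linarith [hR x hx])
      gcongr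
  have hLip : ∀ x ∈ Ω, ∀ t ∈ Set.Icc (0:ℝ) 1, ∀ t0 ∈ Set.Icc (0:ℝ) 1,
      |hk d r τ x0 x t - hk d r τ x0 x t0| ≤ CG * |t - t0| := by
    intro x hx t ht t0 ht0
    exact Convex.norm_image_sub_le_of_norm_hasDerivWithin_le (f := hk d r τ x0 x)
        (f' := hkt d r τ x0 x) (C := CG) (s := Set.Icc (0:ℝ) 1)
        (fun y hy => (hkd x y hy).hasDerivWithinAt) (fun y hy => hktb x hx y hy) (convex_Icc 0 1) ht0 ht
  have hcΦ := Phi_cont hopen hb h hS0 hS hε (G := hk d r τ x0) (fun s _ => (hk2 s).continuous.continuousOn)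
      (fun x _ s hs => hkb x s hs) (fun x _ t ht => (hkd x t ht).continuousAt.continuousWithinAt)
  have hsub : Set.Icc (1 - η) 1 ⊆ Set.Icc (0:ℝ) 1 := Set.Icc_subset_Icc_left (by linarith [hη.2])
  have hsd : ∀ t : ℝ, HasDerivAt (fun t : ℝ => 1 + τ - t) (-1) t := fun t => by
    simpa using (hasDerivAt_id t).const_sub (1 + τ)
  have hmain := ode_le (t1 := 1 - η) (hcΦ.mono hsub)
    (B := fun t => (-2 * c1 * S ^ 3) * Real.sqrt (1 + τ - t) + c2 * ε * S ^ 2 * t)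
    (B' := fun t => c1 * S ^ 3 * (Real.sqrt (1 + τ - t))⁻¹ + c2 * ε * S ^ 2) (by fun_prop)
    (fun t ht => by
      have h1 := hspos t (hsub ⟨ht.1.le, ht.2.le⟩)
      have h2 := ((hsd t).sqrt h1.ne').const_mul (-2 * c1 * S ^ 3)
      have h3 := (hasDerivAt_id t).const_mul (c2 * ε * S ^ 2)
      refine (h2.add h3).congr_deriv ?_
      have := (Real.sqrt_pos.2 h1).ne'
      field_simp)
    (fun t0 ht0 => by
      have ht0I : t0 ∈ Set.Ioo (0:ℝ) 1 := ⟨by linarith [ht0.1, hη.2], ht0.2⟩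
      have ht0' : t0 ∈ Set.Icc (0:ℝ) 1 := ⟨ht0I.1.le, ht0.2.le⟩
      have hs := hspos t0 ht0'
      obtain ⟨D, hD1, hD2, hD3⟩ := energy_deriv hopen hb hd ha haC hdiv hf hfr h hS0 hS ht0I hε
        (G := hk d r τ x0) (Gt := fun x => hkt d r τ x0 x t0) hCG0
        (fun s _ => hk2 s) (fun x => hk0 x t0 ht0') (by
          unfold hkt
          have := (hk2 t0).continuous
          fun_prop)
        (fun x _ s hs => hkb x s hs) (fun x hx s hs => hLip x hx s hs t0 ht0') (fun x _ => hkd x t0 ht0')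
      refine ⟨D, hD1, hD3.trans ?_⟩
      have e0 : 0 ≤ ∫ x in Ω, 6 * d * max (u x t0 - ε) 0 * (∑ i, (pd (fun y => u y t0) i x) ^ 2) * hk d r τ x0 x t0 := by
        refine integral_nonneg fun x => ?_
        have h1 := hk0 x t0 ht0'
        have h2 : 0 ≤ max (u x t0 - ε) 0 := le_max_right _ _
        have h3 : 0 ≤ (∑ i, (pd (fun y => u y t0) i x) ^ 2) := Finset.sum_nonneg fun i _ => sq_nonneg _
        simp only [Pi.zero_apply]
        positivity
      set s := 1 + τ - t0 with hsdef
      set b := (8 * d * s)⁻¹ with hbdef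
      have hb0 : 0 < b := by positivity
      obtain ⟨gi, ge⟩ := gauss_int x0 hb0
      set c3 := S ^ 3 * (A * Real.sqrt (8 * d) / d * (Real.sqrt s)⁻¹) + 3 * |r| * ε * S ^ 2 with hc3
      have hc30 : 0 ≤ c3 := by positivity
      have hi : Integrable (fun x => c3 * (Real.exp (3 * |r|) * s⁻¹) * Real.exp (-(b * ‖x - x0‖ ^ 2))) :=
        gi.const_mul _
      have e1 : ∫ x in Ω, ((max (u x t0 - ε) 0) ^ 3 * (d * lap (fun y => hk d r τ x0 y t0) x
          + (∑ i, a x i * pd (fun y => hk d r τ x0 y t0) i x) + hkt d r τ x0 x t0 + 3 * r * hk d r τ x0 x t0)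
          + 3 * |r| * ε * (max (u x t0 - ε) 0) ^ 2 * hk d r τ x0 x t0) ≤
          ∫ x, c3 * (Real.exp (3 * |r|) * s⁻¹) * Real.exp (-(b * ‖x - x0‖ ^ 2)) := by
        refine le_trans (setIntegral_mono_on hD2 hi.integrableOn hopen.measurableSet (fun x hx => ?_))
          (setIntegral_le_integral hi (ae_of_all _ fun x => by simp only [Pi.zero_apply]; positivity))
        have hh := hk_heat (r := r) hd x0 x hs
        have hg := hk_grad (r := r) hd x0 x ht0' hs (a x) (ha x hx)
        have hl := hk_le (r := r) hd x0 x ht0' hs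
        have hq0 : 0 ≤ max (u x t0 - ε) 0 := le_max_right _ _
        have hqS : max (u x t0 - ε) 0 ≤ S := max_le (by linarith [hS x (subset_closure hx) t0 ht0']) hS0
        set q := max (u x t0 - ε) 0
        set Z := Real.exp (3 * |r|) * s⁻¹ * Real.exp (-(b * ‖x - x0‖ ^ 2)) with hZ
        have hZ0 : 0 ≤ Z := by positivity
        set T := ∑ i, a x i * pd (fun y => hk d r τ x0 y t0) i x
        have f1 : q ^ 3 * T ≤ S ^ 3 * (A * Real.sqrt (8 * d) / d * (Real.sqrt s)⁻¹ * Z) := by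
          have hq3 : q ^ 3 ≤ S ^ 3 := pow_le_pow_left₀ hq0 hqS 3
          have hR0 : 0 ≤ A * Real.sqrt (8 * d) / d * (Real.sqrt s)⁻¹ * Z := by positivity
          exact (mul_le_mul_of_nonneg_left hg (pow_nonneg hq0 3)).trans (mul_le_mul_of_nonneg_right hq3 hR0)
        have f2 : 3 * |r| * ε * q ^ 2 * hk d r τ x0 x t0 ≤ 3 * |r| * ε * S ^ 2 * Z := by
          have := hk0 x t0 ht0'
          gcongr
        have f3 : q ^ 3 * (d * lap (fun y => hk d r τ x0 y t0) x + T + hkt d r τ x0 x t0 + 3 * r * hk d r τ x0 x t0)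
            = q ^ 3 * T := by
          linear_combination q ^ 3 * hh
        rw [f3]
        refine (add_le_add f1 f2).trans (le_of_eq ?_)
        rw [hc3, hZ]; ring
      rw [integral_const_mul, ge] at e1
      have e2 : c3 * (Real.exp (3 * |r|) * s⁻¹) * (Real.pi / b) = c1 * S ^ 3 * (Real.sqrt s)⁻¹ + c2 * ε * S ^ 2 := by
        rw [hc3, hc1, hc2, hbdef]
        have := (Real.sqrt_pos.2 hs).ne'
        have := hs.ne'
        have := hd.ne'
        field_simp
        ring
      linarith) 1 ⟨by linarith [hη.1], le_rfl⟩
  have h1η : 1 - η ∈ Set.Icc (0:ℝ) 1 := ⟨by linarith [hη.2], by linarith [hη.1]⟩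
  have g1 : Real.sqrt (1 + τ - (1 - η)) ≤ Real.sqrt τ + Real.sqrt η := by
    rw [show 1 + τ - (1 - η) = τ + η by ring]
    rw [Real.sqrt_le_left (by positivity)]
    nlinarith [Real.sq_sqrt hτ.le, Real.sq_sqrt hη.1.le, mul_nonneg (Real.sqrt_nonneg τ) (Real.sqrt_nonneg η)]
  have g2 : ∫ x in Ω, (max (u x (1 - η) - ε) 0) ^ 3 * hk d r τ x0 x (1 - η) ≤
      Real.exp (3 * |r|) / η * (∫ x in Ω, u x (1 - η) ^ 3) := by
    rw [← integral_const_mul]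
    have ic1 : IntegrableOn (fun x => (max (u x (1 - η) - ε) 0) ^ 3 * hk d r τ x0 x (1 - η)) Ω :=
      ((((((sol_slice h h1η).sub continuousOn_const).sup continuousOn_const).pow 3).mul
        (hk2 (1 - η)).continuous.continuousOn).integrableOn_compact hKc).mono_set subset_closure
    have ic2 : IntegrableOn (fun x => Real.exp (3 * |r|) / η * u x (1 - η) ^ 3) Ω :=
      ((continuousOn_const.mul ((sol_slice h h1η).pow 3)).integrableOn_compact hKc).mono_set subset_closure
    refine setIntegral_mono_on ic1 ic2 hopen.measurableSet (fun x hx => ?_)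
    have hu := h.nonneg x (subset_closure hx) (1 - η) h1η
    have h1 : (max (u x (1 - η) - ε) 0) ^ 3 ≤ u x (1 - η) ^ 3 :=
      pow_le_pow_left₀ (le_max_right _ _) (max_le (by linarith) hu) 3
    have h2 : hk d r τ x0 x (1 - η) ≤ Real.exp (3 * |r|) / η := by
      refine (hkle x (1 - η) h1η).trans ?_
      rw [div_eq_mul_inv]
      have := hη.1
      have : η ≤ 1 + τ - (1 - η) := by linarith
      gcongr
    rw [mul_comm]
    exact mul_le_mul h2 h1 (pow_nonneg (le_max_right _ _) 3) ((hk0 x _ h1η).trans h2)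
  rw [show 1 + τ - 1 = τ by ring] at hmain
  have g3 := mul_le_mul_of_nonneg_left g1 (by positivity : 0 ≤ 2 * c1 * S ^ 3)
  have g4 : c2 * ε * S ^ 2 * η ≤ c2 * ε * S ^ 2 := mul_le_of_le_one_right (by positivity) hη.2.le
  nlinarith [hmain, g2, g3, g4]

lemma smooth {Ω : Set E2} (hopen : IsOpen Ω) (hb : Bornology.IsBounded Ω) {d A S r : ℝ} (hd : 0 < d)
    (hA : 0 ≤ A)
    {a : E2 → E2} (ha : ∀ x ∈ Ω, ∀ i, |a x i| ≤ A) (haC : ContDiffOn ℝ 1 a (closure Ω))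
    (hdiv : ∀ x ∈ Ω, (∑ i, pd (fun y => a y i) i x) = 0)
    {f : ℝ → ℝ} (hf : Continuous f) (hfr : ∀ s, 0 ≤ s → f s ≤ r * s)
    {u : E2 → ℝ → ℝ} (h : OneSol Ω d a f u) (hS0 : 0 ≤ S)
    (hS : ∀ x ∈ closure Ω, ∀ t ∈ Set.Icc (0:ℝ) 1, u x t ≤ S)
    {η : ℝ} (hη : η ∈ Set.Ioo (0:ℝ) 1) (x0 : E2) (hx0 : x0 ∈ Ω) :
    Real.pi * Real.exp (-(3 * |r|)) * Real.exp (-(4 * d)⁻¹) * u x0 1 ^ 3 ≤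
      Real.exp (3 * |r|) / η * (∫ x in Ω, u x (1 - η) ^ 3)
      + 2 * (8 * Real.pi * Real.exp (3 * |r|) * (A * Real.sqrt (8 * d))) * S ^ 3 * Real.sqrt η := by
  have h11 : (1:ℝ) ∈ Set.Icc (0:ℝ) 1 := ⟨zero_le_one, le_rfl⟩
  have hKc : IsCompact (closure Ω) := Metric.isCompact_of_isClosed_isBounded isClosed_closure hb.closure
  set c0 := Real.pi * Real.exp (-(3 * |r|)) * Real.exp (-(4 * d)⁻¹) with hc0
  have hc0p : 0 < c0 := by positivity
  have hu0 := h.nonneg x0 (subset_closure hx0) 1 h11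
  have hu0S := hS x0 (subset_closure hx0) 1 h11
  set K := 6 * c0 * S ^ 2 + 24 * Real.pi * d * Real.exp (3 * |r|) * |r| * S ^ 2 with hK
  have hK0 : 0 ≤ K := by positivity
  refine le_of_forall_pos_le_add (fun e he => ?_)
  set δ := e / (K + 1) with hδ
  have hδ0 : 0 < δ := by positivity
  have hδe : δ * K ≤ e := by
    rw [hδ, div_mul_eq_mul_div, div_le_iff₀ (by positivity)]
    nlinarith
  have hca : ContinuousAt (fun x => u x 1) x0 :=
    (sol_slice h h11).continuousAt (mem_of_superset (hopen.mem_nhds hx0) subset_closure)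
  have hev : ∀ᶠ x in 𝓝 x0, x ∈ Ω ∧ u x0 1 - δ < u x 1 :=
    (hopen.eventually_mem hx0).and (hca.eventually (lt_mem_nhds (by linarith)))
  obtain ⟨ρ, hρ, hball⟩ := Metric.eventually_nhds_iff_ball.1 hev
  set τ := ρ ^ 2 with hτ
  have hτ0 : 0 < τ := by positivity
  have hpre := smooth_pre hopen hb hd hA ha haC hdiv hf hfr h hS0 hS hη hτ0 hδ0 x0
  set q0 := max (u x0 1 - 2 * δ) 0 with hq0
  have hq00 : 0 ≤ q0 := le_max_right _ _
  have hq0u : q0 ≤ u x0 1 := max_le (by linarith) hu0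
  have hlow : c0 * q0 ^ 3 ≤ ∫ x in Ω, (max (u x 1 - δ) 0) ^ 3 * hk d r τ x0 x 1 := by
    have hbs : Metric.ball x0 ρ ⊆ Ω := fun x hx => (hball x hx).1
    have hkc : Continuous (fun x => hk d r τ x0 x 1) := by unfold hk; fun_prop
    have ic1 : IntegrableOn (fun x => (max (u x 1 - δ) 0) ^ 3 * hk d r τ x0 x 1) Ω :=
      ((((((sol_slice h h11).sub continuousOn_const).sup continuousOn_const).pow 3).mul
        hkc.continuousOn).integrableOn_compact hKc).mono_set subset_closure
    have s1 : ∫ x in Metric.ball x0 ρ, (max (u x 1 - δ) 0) ^ 3 * hk d r τ x0 x 1 ≤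
        ∫ x in Ω, (max (u x 1 - δ) 0) ^ 3 * hk d r τ x0 x 1 := by
      refine setIntegral_mono_set ic1 (Eventually.of_forall fun x => ?_) (Eventually.of_forall hbs)
      have : 0 < 1 + τ - 1 := by linarith
      have : 0 ≤ hk d r τ x0 x 1 := by unfold hk; positivity
      exact mul_nonneg (pow_nonneg (le_max_right _ _) 3) this
    refine le_trans ?_ s1
    have s2 : ∫ x in Metric.ball x0 ρ, (q0 ^ 3 * (Real.exp (-(3 * |r|)) * τ⁻¹ * Real.exp (-(4 * d)⁻¹))) ≤
        ∫ x in Metric.ball x0 ρ, (max (u x 1 - δ) 0) ^ 3 * hk d r τ x0 x 1 := by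
      refine setIntegral_mono_on (integrableOn_const measure_ball_lt_top.ne) (ic1.mono_set hbs)
        Metric.isOpen_ball.measurableSet (fun x hx => ?_)
      have hx2 := (hball x hx).2
      have hm : q0 ≤ max (u x 1 - δ) 0 := max_le_max (by linarith) le_rfl
      have hkl : Real.exp (-(3 * |r|)) * τ⁻¹ * Real.exp (-(4 * d)⁻¹) ≤ hk d r τ x0 x 1 := by
        unfold hk
        rw [show 1 + τ - 1 = τ by ring]
        have e1 : -(3 * |r|) ≤ -(3 * r * 1) := by linarith [le_abs_self r]
        have e2 : (4 * d * τ)⁻¹ * ‖x - x0‖ ^ 2 ≤ (4 * d)⁻¹ := by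
          have : ‖x - x0‖ ^ 2 ≤ τ := by
            rw [hτ]
            refine pow_le_pow_left₀ (norm_nonneg _) ?_ 2
            rw [← dist_eq_norm]; exact (Metric.mem_ball.1 hx).le
          rw [mul_inv, mul_assoc]
          refine mul_le_of_le_one_right (by positivity) ?_
          rw [inv_mul_le_iff₀ hτ0]; linarith
        gcongr
      have := pow_le_pow_left₀ hq00 hm 3
      gcongr
    refine le_trans (le_of_eq ?_) s2
    rw [setIntegral_const, measureReal_def, EuclideanSpace.volume_ball_fin_two, smul_eq_mul]
    rw [ENNReal.toReal_mul, ENNReal.toReal_pow, ENNReal.toReal_ofReal hρ.le]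
    rw [hc0, hτ]
    have : (ENNReal.ofReal Real.pi).toReal = Real.pi := ENNReal.toReal_ofReal Real.pi_pos.le
    rw [this]
    have := hρ.ne'
    field_simp
  have hcl := (abs_le.1 (cube_lip hu0 hq00 hu0S (hq0u.trans hu0S))).2
  have hd2 : |u x0 1 - q0| ≤ 2 * δ := by
    rw [abs_of_nonneg (by linarith)]
    linarith [le_max_left (u x0 1 - 2 * δ) 0]
  have h6 : u x0 1 ^ 3 - q0 ^ 3 ≤ 3 * S ^ 2 * (2 * δ) :=
    hcl.trans (mul_le_mul_of_nonneg_left hd2 (by positivity))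
  have h7 := mul_le_mul_of_nonneg_left h6 hc0p.le
  have h8 : δ * K = c0 * (3 * S ^ 2 * (2 * δ)) + 24 * Real.pi * d * Real.exp (3 * |r|) * |r| * δ * S ^ 2 := by
    rw [hK]; ring
  linarith

lemma one_of_imp {Ω : Set E2} {d : ℝ} {a : E2 → E2} {f g : ℝ → ℝ} (sol : ImpSol 2 Ω d a f g) (m : ℕ) :
    OneSol Ω d a f (sol.u m) where
  nonneg := sol.u_nonneg m
  cont := sol.u_cont m
  C2 := sol.u_space_C2 m
  C1 := fun x hx t ht => (sol.u_time_C1 m x hx t ht).differentiableAt one_ne_zero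
  pde := sol.pde m
  bdry := by
    intro x hx t ht
    rcases eq_or_lt_of_le ht.1 with h0 | h0
    · subst h0
      have hxc : x ∈ closure Ω := frontier_subset_closure hx
      have hc : ContinuousOn (fun t => sol.u m x t) (Set.Icc (0:ℝ) 1) :=
        (sol.u_cont m).comp (f := fun t : ℝ => ((x, t) : E2 × ℝ)) (by fun_prop) (fun t ht => ⟨hxc, ht⟩)
      have h1 : Tendsto (fun t => sol.u m x t) (𝓝[Set.Ioc (0:ℝ) 1] 0) (𝓝 (sol.u m x 0)) :=
        (hc 0 ht).mono_left (nhdsWithin_mono _ Set.Ioc_subset_Icc_self)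
      have h2 : Tendsto (fun t => sol.u m x t) (𝓝[Set.Ioc (0:ℝ) 1] 0) (𝓝 0) := by
        refine tendsto_const_nhds.congr' ?_
        filter_upwards [self_mem_nhdsWithin] with s hs
        exact (sol.bdry m x hx s hs).symm
      have : NeBot (𝓝[Set.Ioc (0:ℝ) 1] 0) := by
        rw [← mem_closure_iff_nhdsWithin_neBot, closure_Ioc zero_ne_one]
        exact ht
      exact tendsto_nhds_unique h1 h2
    · exact sol.bdry m x hx t ⟨h0, ht.2⟩

lemma final_aux
    (d : ℝ) (hd : 0 < d)
    (Ω : Set E2)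
    (hopen : IsOpen Ω) (hne : Ω.Nonempty) (hb : Bornology.IsBounded Ω)
    (a : E2 → E2)
    (haC : ContDiffOn ℝ 1 a (closure Ω))
    (hdiv : ∀ x ∈ Ω, (∑ i, pd (fun y => a y i) i x) = 0)
    (f g : ℝ → ℝ) (r G : ℝ) (hf : SatF f r) (hg : SatGext g G)
    (hpos : 0 < r + Real.log G)
    (hvol : volume Ω < ENNReal.ofReal (2 * d * Real.pi / (r + Real.log G)))
    (sol : ImpSol 2 Ω d a f g) :
    ∃ k q : ℝ, 0 ≤ q ∧ q < 1 ∧ ∀ m, ∀ x ∈ closure Ω, sol.N m x ≤ k * q ^ m := by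
  obtain ⟨hfl, -, -, -, hh, -, -, -, hfb⟩ := hf
  obtain ⟨-, hg0, -, -, hG, hgb⟩ := hg
  have hfc : Continuous f := hfl.continuous
  have hfr : ∀ s, 0 ≤ s → f s ≤ r * s := fun s hs => (hfb s hs).2
  have hgle : ∀ s, 0 ≤ s → g s ≤ G * s := by
    intro s hs
    rcases eq_or_lt_of_le hs with h | h
    · rw [← h, hg0]; simp
    · exact hgb s h
  have hfin : volume Ω < ⊤ := hb.measure_lt_top
  have hKc : IsCompact (closure Ω) := Metric.isCompact_of_isClosed_isBounded isClosed_closure hb.closure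
  have h00 : (0:ℝ) ∈ Set.Icc (0:ℝ) 1 := ⟨le_rfl, zero_le_one⟩
  have h11 : (1:ℝ) ∈ Set.Icc (0:ℝ) 1 := ⟨zero_le_one, le_rfl⟩
  have hV : 0 < (volume Ω).toReal := ENNReal.toReal_pos (hopen.measure_pos volume hne).ne' hfin.ne
  have hVlt := (ENNReal.lt_ofReal_iff_toReal_lt hfin.ne).1 hvol
  set V := (volume Ω).toReal with hVdef
  obtain ⟨A, hA⟩ := hKc.exists_bound_of_continuousOn haC.continuousOn
  have hA0 : 0 ≤ A := by
    obtain ⟨x, hx⟩ := hne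
    exact (norm_nonneg _).trans (hA x (subset_closure hx))
  have ha : ∀ x ∈ Ω, ∀ i, |a x i| ≤ A := fun x hx i =>
    (PiLp.norm_apply_le (a x) i).trans (hA x (subset_closure hx))
  set κ := 3 * r - 64 * d / (3 * V) with hκ
  -- energy
  set γ := G ^ 3 * Real.exp κ with hγ
  have hγ0 : 0 ≤ γ := by positivity
  have hγ1 : γ < 1 := by
    have hGe : G ^ 3 = Real.exp (3 * Real.log G) := by
      rw [show (3:ℝ) * Real.log G = ((3:ℕ):ℝ) * Real.log G by norm_num, Real.exp_nat_mul, Real.exp_log hG]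
    rw [hγ, hGe, ← Real.exp_add, Real.exp_lt_one_iff]
    rw [lt_div_iff₀ hpos] at hVlt
    have h1 : 3 * (r + Real.log G) < 64 * d / (3 * V) := by
      rw [lt_div_iff₀ (by positivity)]
      nlinarith [Real.pi_lt_d2]
    rw [hκ]; linarith
  set En := fun m => ∫ x in Ω, sol.N m x ^ 3 with hEn
  have hNint : ∀ m, IntegrableOn (fun x => sol.N m x ^ 3) Ω := fun m =>
    (((sol.N_cont m).pow 3).integrableOn_compact hKc).mono_set subset_closure
  have hE0 : ∀ m, 0 ≤ En m := fun m =>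
    setIntegral_nonneg hopen.measurableSet (fun x hx => pow_nonneg (sol.N_nonneg m x (subset_closure hx)) 3)
  have hinitE : ∀ m, ∫ x in Ω, sol.u m x 0 ^ 3 ≤ G ^ 3 * En m := by
    intro m
    rw [hEn, ← integral_const_mul]
    refine setIntegral_mono_on ?_ ((hNint m).const_mul _) hopen.measurableSet (fun x hx => ?_)
    · exact (((sol_slice (one_of_imp sol m) h00).pow 3).integrableOn_compact hKc).mono_set subset_closure
    · rw [← mul_pow]
      refine pow_le_pow_left₀ (sol.u_nonneg m x (subset_closure hx) 0 h00) ?_ 3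
      rw [sol.init m x hx]
      exact hgle _ (sol.N_nonneg m x (subset_closure hx))
  have hsup : ∀ m Y, 0 ≤ Y → (∀ x ∈ closure Ω, sol.N m x ≤ Y) →
      ∀ x ∈ closure Ω, ∀ t ∈ Set.Icc (0:ℝ) 1, sol.u m x t ≤ Real.exp (|r| + 1) * (G * Y) := by
    intro m Y hY hN
    refine sup_bound hopen hb hd hfr (one_of_imp sol m) (by positivity) (fun x hx => ?_)
    rw [sol.init m x hx]
    exact (hgle _ (sol.N_nonneg m x (subset_closure hx))).trans
      (mul_le_mul_of_nonneg_left (hN x (subset_closure hx)) hG.le)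
  set L := Real.exp (|r| + 1) * G with hL
  have hL0 : 0 ≤ L := by positivity
  set c0 := Real.pi * Real.exp (-(3 * |r|)) * Real.exp (-(4 * d)⁻¹) with hc0
  have hc0p : 0 < c0 := by positivity
  set D := 2 * (8 * Real.pi * Real.exp (3 * |r|) * (A * Real.sqrt (8 * d))) * L ^ 3 with hD
  have hD0 : 0 ≤ D := by positivity
  set s := min (1 / 2) (c0 / (2 * (D + 1))) with hs
  have hs0 : 0 < s := lt_min (by norm_num) (by positivity)
  have hs1 : s ≤ 1 / 2 := min_le_left _ _
  have hDs : D * s ≤ c0 / 2 := by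
    have h1 : s ≤ c0 / (2 * (D + 1)) := min_le_right _ _
    rw [le_div_iff₀ (by positivity)] at h1
    nlinarith
  have hη : s ^ 2 ∈ Set.Ioo (0:ℝ) 1 := ⟨by positivity, by nlinarith⟩
  have h1η : 1 - s ^ 2 ∈ Set.Icc (0:ℝ) 1 := ⟨by linarith [hη.2], by linarith [hη.1]⟩
  set B := Real.exp (3 * |r|) / s ^ 2 * (Real.exp |κ| * G ^ 3) with hB
  have hB0 : 0 ≤ B := by positivity
  have hstep : ∀ m Y, 0 ≤ Y → (∀ x ∈ closure Ω, sol.N m x ≤ Y) →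
      En (m + 1) ≤ γ * En m ∧ ∀ x ∈ Ω, sol.N (m + 1) x ^ 3 ≤ B / c0 * En m + 1 / 2 * Y ^ 3 := by
    intro m Y hY hN
    have hS := hsup m Y hY hN
    have hS0 : 0 ≤ Real.exp (|r| + 1) * (G * Y) := by positivity
    have hO := one_of_imp sol m
    constructor
    · have h1 := energy_decay hopen hb hd ha haC hdiv hfc hfr hO hS0 hS hV h11
      rw [mul_one] at h1
      have h2 : En (m + 1) = ∫ x in Ω, sol.u m x 1 ^ 3 := by
        refine setIntegral_congr_fun hopen.measurableSet (fun x hx => ?_)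
        simp only [sol.recur m x (subset_closure hx)]
      rw [h2]
      refine h1.trans ((mul_le_mul_of_nonneg_left (hinitE m) (Real.exp_pos _).le).trans (le_of_eq ?_))
      rw [hγ]; ring
    · intro x hx
      have h1 := energy_decay hopen hb hd ha haC hdiv hfc hfr hO hS0 hS hV h1η
      have h2 : ∫ x in Ω, sol.u m x (1 - s ^ 2) ^ 3 ≤ Real.exp |κ| * (G ^ 3 * En m) := by
        refine h1.trans ?_
        have e1 : κ * (1 - s ^ 2) ≤ |κ| := by
          refine (le_abs_self _).trans ?_
          rw [abs_mul, abs_of_nonneg h1η.1]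
          exact mul_le_of_le_one_right (abs_nonneg _) h1η.2
        have e2 : 0 ≤ ∫ x in Ω, sol.u m x 0 ^ 3 :=
          setIntegral_nonneg hopen.measurableSet
            (fun x hx => pow_nonneg (sol.u_nonneg m x (subset_closure hx) 0 h00) 3)
        exact mul_le_mul (Real.exp_le_exp.2 e1) (hinitE m) e2 (Real.exp_pos _).le
      have h3 := smooth hopen hb hd hA0 ha haC hdiv hfc hfr hO hS0 hS hη x hx
      rw [Real.sqrt_sq hs0.le] at h3
      have h4 : Real.exp (3 * |r|) / s ^ 2 * (∫ x in Ω, sol.u m x (1 - s ^ 2) ^ 3) ≤ B * En m := by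
        refine (mul_le_mul_of_nonneg_left h2 (by positivity)).trans (le_of_eq ?_)
        rw [hB]; ring
      have h5 : 2 * (8 * Real.pi * Real.exp (3 * |r|) * (A * Real.sqrt (8 * d))) *
          (Real.exp (|r| + 1) * (G * Y)) ^ 3 * s = D * s * Y ^ 3 := by
        rw [hD, hL]; ring
      rw [h5] at h3
      have h6 := mul_le_mul_of_nonneg_right hDs (pow_nonneg hY 3)
      rw [sol.recur m x (subset_closure hx)]
      have h7 : c0 * sol.u m x 1 ^ 3 ≤ c0 * (B / c0 * En m + 1 / 2 * Y ^ 3) := by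
        have : c0 * (B / c0 * En m + 1 / 2 * Y ^ 3) = B * En m + c0 / 2 * Y ^ 3 := by
          field_simp
        rw [this]; linarith
      exact le_of_mul_le_mul_left h7 hc0p
  obtain ⟨M, hM⟩ := hKc.exists_bound_of_continuousOn (sol.N_cont 0)
  set p := max γ (3 / 4) with hp
  have hp0 : 0 ≤ p := hγ0.trans (le_max_left _ _)
  have hp1 : p < 1 := max_lt hγ1 (by norm_num)
  set q := p ^ ((1:ℝ) / 3) with hq
  have hq0 : 0 ≤ q := Real.rpow_nonneg hp0 _
  have hq3 : q ^ 3 = p := by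
    rw [hq, ← Real.rpow_natCast, ← Real.rpow_mul hp0]; norm_num
  have hq1 : q < 1 := Real.rpow_lt_one hp0 hp1 (by norm_num)
  set k := max 1 (max M (4 * (B / c0 * En 0))) with hk
  have hk1 : 1 ≤ k := le_max_left _ _
  have hkM : M ≤ k := (le_max_left _ _).trans (le_max_right _ _)
  have hkB : 4 * (B / c0 * En 0) ≤ k ^ 3 := by
    have : k ≤ k ^ 3 := le_self_pow₀ hk1 (by norm_num)
    exact ((le_max_right _ _).trans (le_max_right _ _)).trans this
  have hind : ∀ m, En m ≤ En 0 * p ^ m ∧ ∀ x ∈ closure Ω, sol.N m x ≤ k * q ^ m := by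
    intro m
    induction m with
    | zero =>
      refine ⟨by simp, fun x hx => ?_⟩
      have := hM x hx
      rw [pow_zero, mul_one]
      exact ((le_abs_self _).trans this).trans hkM
    | succ m ih =>
      obtain ⟨i1, i2⟩ := ih
      have hY : 0 ≤ k * q ^ m := by positivity
      obtain ⟨s1, s2⟩ := hstep m _ hY i2
      refine ⟨?_, fun x hx => ?_⟩
      · calc En (m + 1) ≤ γ * En m := s1
          _ ≤ p * (En 0 * p ^ m) := mul_le_mul (le_max_left _ _) i1 (hE0 m) hp0
          _ = _ := by ring
      · by_cases hxΩ : x ∈ Ω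
        · have t1 := s2 x hxΩ
          have t2 : B / c0 * En m ≤ B / c0 * (En 0 * p ^ m) := mul_le_mul_of_nonneg_left i1 (by positivity)
          have t3 : (k * q ^ m) ^ 3 = k ^ 3 * p ^ m := by
            rw [mul_pow, ← pow_mul, mul_comm m 3, pow_mul, hq3]
          have t4 : (k * q ^ (m + 1)) ^ 3 = k ^ 3 * p ^ m * p := by
            rw [mul_pow, ← pow_mul, mul_comm (m + 1) 3, pow_mul, hq3]; ring
          have t5 : 0 ≤ p ^ m := by positivity
          have t6 := mul_le_mul_of_nonneg_right hkB t5
          have t7 : k ^ 3 * p ^ m * (3 / 4) ≤ k ^ 3 * p ^ m * p :=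
            mul_le_mul_of_nonneg_left (le_max_right _ _) (by positivity)
          rw [t3] at t1
          have t8 : sol.N (m + 1) x ^ 3 ≤ (k * q ^ (m + 1)) ^ 3 := by
            rw [t4]; linarith
          exact le_of_pow_le_pow_left₀ (by norm_num) (by positivity) t8
        · have hfr' : x ∈ frontier Ω := ⟨hx, by rwa [hopen.interior_eq]⟩
          rw [sol.recur m x hx, sol.bdry m x hfr' 1 ⟨zero_lt_one, le_rfl⟩]
          positivity
  exact ⟨k, q, hq0, hq1, fun m => (hind m).2⟩

/-- Extinction on a smooth bounded planar domain of area below the extreme volume size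
`V_ex = 2dπ/(f'(0)+ln g'(0))`, with divergence free drift. -/
theorem extreme_volume_extinction_dim2
    (d : ℝ) (hd : 0 < d)
    (Ω : Set (EuclideanSpace ℝ (Fin 2)))
    (hopen : IsOpen Ω) (hne : Ω.Nonempty) (hbdd : Bornology.IsBounded Ω)
    (hbd : HasCkBoundary ⊤ Ω)
    (a : EuclideanSpace ℝ (Fin 2) → EuclideanSpace ℝ (Fin 2))
    (ha : ContDiffOn ℝ 1 a (closure Ω))
    (hdiv : ∀ x ∈ Ω, (∑ i, pd (fun y => a y i) i x) = 0)
    (f g : ℝ → ℝ) (f'0 g'0 : ℝ) (hf : SatF f f'0) (hg : SatGext g g'0)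
    (hpos : 0 < f'0 + Real.log g'0)
    (hvol : volume Ω < ENNReal.ofReal (2 * d * Real.pi / (f'0 + Real.log g'0)))
    (sol : ImpSol 2 Ω d a f g) :
    ∀ x ∈ Ω, Tendsto (fun m => sol.N m x) atTop (𝓝 0) := by
  intro x hx
  obtain ⟨k, q, hq0, hq1, hN⟩ := final_aux d hd Ω hopen hne hbdd a ha hdiv f g f'0 g'0 hf hg hpos hvol sol
  have h1 : Tendsto (fun m : ℕ => k * q ^ m) atTop (𝓝 0) := by
    have := (tendsto_pow_atTop_nhds_zero_of_lt_one hq0 hq1).const_mul k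
    rwa [mul_zero] at this
  exact squeeze_zero (fun m => sol.N_nonneg m x (subset_closure hx))
    (fun m => hN m x (subset_closure hx)) h1
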